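/- Alternative coefficient side for the mixture ρ_g: Let −1 ≤ g ≤ 0 and let ρ_g = |g|·SC + (1−|g|)·Arcsine. For every nontrivial symmetric probability measure μ on [−2,2] with Jacobi coefficients (a_k, b_k) (so b_k = 0 for all k): K(ρ_g | μ) = C_g + |g|·∑_{k=1}^∞ (a_k² − 1 − log a_k²) + (1−|g|)·(log 2 − ∑_{k=1}^∞ log a_k²), where C_g = −|g|(1 − log 2) + 1 − √(1−g²) + log((1+√(1−g²))/2), and where both sides may be infinite simultaneously. -/

import Mathlib

open MeasureTheory Real Filter Set Topology Polynomial
open scoped ENNReal ComplexConjugate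

noncomputable section

namespace SumRules

-- Kullback–Leibler divergence `K(ν | μ)`.
open Classical in
def KLdiv {α : Type*} [MeasurableSpace α] (ν μ : Measure α) : ℝ≥0∞ :=
  if ν ≪ μ ∧ Integrable (llr ν μ) ν then ENNReal.ofReal (∫ x, llr ν μ x ∂ν) else ⊤

/-- The (topological) support of a measure. -/
def suppSet {α : Type*} [TopologicalSpace α] [MeasurableSpace α] (μ : Measure α) : Set α :=
  {x | ∀ U ∈ nhds x, μ U ≠ 0}

/-- A measure is nontrivial if its support is infinite, i.e. it is not carried
by any finite set. -/
def InfiniteSupport {α : Type*} [MeasurableSpace α] (μ : Measure α) : Prop :=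
  ∀ s : Finset α, μ (↑s : Set α)ᶜ ≠ 0

/-- The set of support points outside `[cm, cp]`. -/
def ES (μ : Measure ℝ) (cm cp : ℝ) : Set ℝ := suppSet μ \ Icc cm cp

/-- `μ ∈ 𝒮₁(cm, cp)`: the support of `μ` is contained in `[cm, cp]` together with an
at most countable set of points outside this interval. -/
def InS1 (μ : Measure ℝ) (cm cp : ℝ) : Prop := (ES μ cm cp).Countable

/-- `a b` (indexed so that `a (k+1) = a_{k+1}`, `b (k+1) = b_{k+1}`, `k ≥ 0`) are the Jacobi
coefficients of `μ`: there is a sequence of orthonormal polynomials (with positive leading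
coefficients, obtained by Gram-Schmidt from `1, x, x², …`) satisfying the three-term recursion. -/
def IsJacobi (μ : Measure ℝ) (a b : ℕ → ℝ) : Prop :=
  (∀ k : ℕ, 0 < a (k+1)) ∧
  ∃ p : ℕ → Polynomial ℝ,
    (∀ k, (p k).natDegree = k) ∧ (∀ k, 0 < (p k).leadingCoeff) ∧
    (∀ j k, ∫ x, (p j).eval x * (p k).eval x ∂μ = if j = k then 1 else 0) ∧
    (∀ (k : ℕ) (x : ℝ), x * (p k).eval x =
      a (k+1) * (p (k+1)).eval x + b (k+1) * (p k).eval x +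
        (if k = 0 then 0 else a k * (p (k-1)).eval x))

/-- `u` is the sequence of canonical moments of a measure on `[-2,2]` (with `u 0 = -1`). -/
def IsCanonicalMoments (μ : Measure ℝ) (u : ℕ → ℝ) : Prop :=
  u 0 = -1 ∧ (∀ k : ℕ, u (k+1) ∈ Ioo (-1 : ℝ) 1) ∧
  ∃ a b : ℕ → ℝ, IsJacobi μ a b ∧
    (∀ k : ℕ, b (k+1) = (1 - u (2*k)) * u (2*k+1) - (1 + u (2*k)) * u (2*k-1)) ∧
    (∀ k : ℕ, (a (k+1))^2 = (1 - u (2*k)) * (1 - (u (2*k+1))^2) * (1 + u (2*k+2)))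

/-- `z` is the sequence of canonical coefficients of a measure supported in `[0,∞)`. -/
def IsCanonicalZ (μ : Measure ℝ) (z : ℕ → ℝ) : Prop :=
  z 0 = 0 ∧ (∀ k : ℕ, 0 ≤ z (k+1)) ∧
  ∃ a b : ℕ → ℝ, IsJacobi μ a b ∧
    (∀ k : ℕ, b (k+1) = z (2*k) + z (2*k+1)) ∧
    (∀ k : ℕ, (a (k+1))^2 = z (2*k+1) * z (2*k+2))

def Gfun (x : ℝ) : ℝ := x - 1 - Real.log x

/-- The semicircle law. -/
def SCm : Measure ℝ :=
  volume.withDensity fun x => ENNReal.ofReal (Real.sqrt (4 - x^2) / (2*π))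

/-- The arcsine law on `(-2,2)`. -/
def ArcsineM : Measure ℝ :=
  volume.withDensity fun x => ENNReal.ofReal (1 / (π * Real.sqrt (4 - x^2)))

/-- The measure with density `(2/(π|q-p|)) √((x-p)/(q-x))` between `p` and `q`. -/
def Dmeas (p q : ℝ) : Measure ℝ :=
  volume.withDensity fun x => ENNReal.ofReal (2/(π * |q - p|) * Real.sqrt ((x - p)/(q - x)))

/-- The point `e^{iθ}` on the unit circle. -/
def ctheta (θ : ℝ) : ℂ := Complex.exp (θ * Complex.I)

/-- Reversed polynomial `Φ*` with conjugated coefficients: `Φ*(z) = z^k conj(Φ(1/conj z))`. -/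
def polyStar (P : Polynomial ℂ) : Polynomial ℂ := (P.map (starRingEnd ℂ)).reverse

/-- `α` is the sequence of Verblunsky coefficients of the measure `ν` on the unit circle
(`ν` being given in angle coordinates, carried by `[0, 2π)`): the monic orthogonal
polynomials of `ν` satisfy the Szegő recursion with coefficients `α`. -/
def IsVerblunsky (ν : Measure ℝ) (α : ℕ → ℂ) : Prop :=
  (∀ k, ‖α k‖ < 1) ∧
  ∃ Φ : ℕ → Polynomial ℂ,
    (∀ k, (Φ k).Monic) ∧ (∀ k, (Φ k).natDegree = k) ∧
    (∀ j k, j ≠ k →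
      ∫ θ, conj ((Φ j).eval (ctheta θ)) * (Φ k).eval (ctheta θ) ∂ν = 0) ∧
    (∀ k, Φ (k+1) = Polynomial.X * Φ k - Polynomial.C (conj (α k)) * polyStar (Φ k))

/-- `γ` is the sequence of deformed Verblunsky coefficients of `ν`. -/
def IsDeformedVerblunsky (ν : Measure ℝ) (γ : ℕ → ℂ) : Prop :=
  ∃ α : ℕ → ℂ, IsVerblunsky ν α ∧
    ∀ k : ℕ, γ k = conj (α k) * ∏ j ∈ Finset.range k, (1 - conj (γ j)) / (1 - γ j)

/-- Symmetry of a measure on the circle (in angle coordinates): invariance under conjugation. -/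
def SymmCircle (ν : Measure ℝ) : Prop :=
  (ν.map ctheta).map (starRingEnd ℂ) = ν.map ctheta

/-- The uniform measure on the circle, in angle coordinates. -/
def UNIFm : Measure ℝ :=
  volume.withDensity fun θ => ENNReal.ofReal (if 0 ≤ θ ∧ θ < 2*π then 1/(2*π) else 0)

end SumRules

namespace SumRules

/-- Outlier contribution for the Killip–Simon sum rule (`+∞` inside `(-2,2)`). -/
def FSC (x : ℝ) : ℝ≥0∞ :=
  if 2 ≤ |x| then
    ENNReal.ofReal (|x|/2 * Real.sqrt (x^2 - 4) - 2 * Real.log ((|x| + Real.sqrt (x^2 - 4))/2))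
  else ⊤

/-- Coefficient side of the Killip–Simon sum rule. -/
def IH (a b : ℕ → ℝ) : ℝ≥0∞ :=
  (1/2 : ℝ≥0∞) * ∑' k : ℕ, ENNReal.ofReal ((b (k+1))^2)
    + ∑' k : ℕ, ENNReal.ofReal (Gfun ((a (k+1))^2))

def tauM (τ : ℝ) : ℝ := (1 - Real.sqrt τ)^2
def tauP (τ : ℝ) : ℝ := (1 + Real.sqrt τ)^2

/-- The Marchenko–Pastur law with parameter `τ`. -/
def MPm (τ : ℝ) : Measure ℝ :=
  volume.withDensity fun x =>
    ENNReal.ofReal (Real.sqrt ((x - tauM τ) * (tauP τ - x)) / (2*π*τ*x))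

/-- Outlier contribution for the Marchenko–Pastur sum rule. -/
def FMP (τ : ℝ) (x : ℝ) : ℝ≥0∞ :=
  if tauP τ ≤ x then
    ENNReal.ofReal (∫ t in (tauP τ)..x, Real.sqrt ((t - tauP τ) * (t - tauM τ)) / (τ*t))
  else if 0 < x ∧ x ≤ tauM τ then
    ENNReal.ofReal (∫ t in x..(tauM τ), Real.sqrt ((t - tauP τ) * (t - tauM τ)) / (τ*t))
  else ⊤

/-- Coefficient side of the Marchenko–Pastur sum rule. -/
def IL (τ : ℝ) (z : ℕ → ℝ) : ℝ≥0∞ :=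
  ∑' k : ℕ, ENNReal.ofReal (τ⁻¹ * Gfun (z (2*k+1)) + Gfun (τ⁻¹ * z (2*k+2)))

def uPl (κ₁ κ₂ : ℝ) : ℝ :=
  2*(κ₂^2 - κ₁^2 + 4*Real.sqrt ((1+κ₁)*(1+κ₂)*(1+κ₁+κ₂)))/(2+κ₁+κ₂)^2
def uMi (κ₁ κ₂ : ℝ) : ℝ :=
  2*(κ₂^2 - κ₁^2 - 4*Real.sqrt ((1+κ₁)*(1+κ₂)*(1+κ₁+κ₂)))/(2+κ₁+κ₂)^2

/-- The Kesten–McKay law with parameters `κ₁, κ₂`. -/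
def KMKm (κ₁ κ₂ : ℝ) : Measure ℝ :=
  volume.withDensity fun x =>
    ENNReal.ofReal ((2+κ₁+κ₂)/(2*π) * Real.sqrt ((x - uMi κ₁ κ₂) * (uPl κ₁ κ₂ - x)) / (4 - x^2))

def ue (κ₁ κ₂ : ℝ) : ℝ := -(κ₁+κ₂)/(2+κ₁+κ₂)
def uo (κ₁ κ₂ : ℝ) : ℝ := (κ₂-κ₁)/(2+κ₁+κ₂)

def He (κ₁ κ₂ u : ℝ) : ℝ :=
  -(1+κ₁+κ₂) * Real.log ((1-u)/(1 - ue κ₁ κ₂)) - Real.log ((1+u)/(1 + ue κ₁ κ₂))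
def Ho (κ₁ κ₂ u : ℝ) : ℝ :=
  -(1+κ₁) * Real.log ((1-u)/(1 - uo κ₁ κ₂)) - (1+κ₂) * Real.log ((1+u)/(1 + uo κ₁ κ₂))

/-- Coefficient side of the Kesten–McKay sum rule. -/
def IJ (κ₁ κ₂ : ℝ) (u : ℕ → ℝ) : ℝ≥0∞ :=
  ∑' k : ℕ, (ENNReal.ofReal (Ho κ₁ κ₂ (u (2*k+1))) + ENNReal.ofReal (He κ₁ κ₂ (u (2*k+2))))

/-- Outlier contribution for the Kesten–McKay sum rule. -/
def FKMK (κ₁ κ₂ : ℝ) (x : ℝ) : ℝ≥0∞ :=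
  if uPl κ₁ κ₂ ≤ x then
    ENNReal.ofReal (∫ t in (uPl κ₁ κ₂)..x,
      (2+κ₁+κ₂) * Real.sqrt ((t - uPl κ₁ κ₂) * (t - uMi κ₁ κ₂)) / (4 - t^2))
  else if x ≤ uMi κ₁ κ₂ then
    ENNReal.ofReal (∫ t in x..(uMi κ₁ κ₂),
      (2+κ₁+κ₂) * Real.sqrt ((t - uPl κ₁ κ₂) * (t - uMi κ₁ κ₂)) / (4 - t^2))
  else ⊤

def Hgw (g : ℝ) : ℝ := 1 - Real.sqrt (1 - g^2) + Real.log ((1 + Real.sqrt (1 - g^2))/2)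

def thetaG (g : ℝ) : ℝ := 2 * Real.arcsin (Real.sqrt (1/|g|))

/-- The Gross–Witten measures, in angle coordinates. -/
def GWm (g : ℝ) : Measure ℝ :=
  if |g| ≤ 1 then
    volume.withDensity fun θ =>
      ENNReal.ofReal (if 0 ≤ θ ∧ θ < 2*π then (1 + g * Real.cos θ)/(2*π) else 0)
  else if g < -1 then
    volume.withDensity fun θ => ENNReal.ofReal (
      if π - thetaG g ≤ θ ∧ θ ≤ π + thetaG g then
        |g| / π * Real.sin (θ/2) * Real.sqrt (Real.sin (θ/2)^2 - Real.cos (thetaG g/2)^2)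
      else 0)
  else
    volume.withDensity fun θ => ENNReal.ofReal (
      if -thetaG g ≤ θ ∧ θ ≤ thetaG g then
        g/π * Real.cos (θ/2) * Real.sqrt (Real.sin (thetaG g/2)^2 - Real.sin (θ/2)^2)
      else 0)

def thetaD (d : ℝ) : ℝ := 2 * Real.arcsin (d/(1+d))
def gammaD (d : ℝ) : ℝ := -d/(1+d)

/-- The Hua–Pickrell measure, in angle coordinates. -/
def HPm (d : ℝ) : Measure ℝ :=
  volume.withDensity fun θ => ENNReal.ofReal (
    if thetaD d < θ ∧ θ < 2*π - thetaD d then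
      (1+d) * Real.sqrt (Real.sin (θ/2)^2 - Real.sin (thetaD d/2)^2) / (2*π*Real.sin (θ/2))
    else 0)

/-- The entropy-like function appearing in the Hua–Pickrell sum rule. -/
def HHP (d : ℝ) (γ : ℂ) : ℝ :=
  -Real.log ((1 - ‖γ‖^2)/(1 - (gammaD d)^2)) - 2*d*Real.log (‖1 - γ‖/(1 - gammaD d))

/-- Outlier contribution for the Hua–Pickrell sum rule (in angle coordinates). -/
def FHP (d : ℝ) (θ : ℝ) : ℝ≥0∞ :=
  if θ ≤ thetaD d then
    ENNReal.ofReal (∫ φ in θ..(thetaD d),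
      (1+d) * Real.sqrt (Real.sin (thetaD d/2)^2 - Real.sin (φ/2)^2) / Real.sin (φ/2))
  else if 2*π - thetaD d ≤ θ then
    ENNReal.ofReal (∫ φ in (2*π - thetaD d)..θ,
      (1+d) * Real.sqrt (Real.sin (thetaD d/2)^2 - Real.sin (φ/2)^2) / Real.sin (φ/2))
  else ⊤

/-- Set of outlying support points for a measure on the circle, in angle coordinates. -/
def EST (ν : Measure ℝ) (tm tp : ℝ) : Set ℝ := suppSet ν \ Icc tm tp

/-- `ν ∈ 𝒮₁^𝕋(tm, tp)` (in angle coordinates). -/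
def InS1T (ν : Measure ℝ) (tm tp : ℝ) : Prop := (EST ν tm tp).Countable

/-- The measure `𝒟(2,-2)`, with density `(1/2π)√((2-x)/(2+x))` on `(-2,2)`
(a shift of the hard-edge Marchenko–Pastur law). -/
def Dhard : Measure ℝ :=
  volume.withDensity fun x => ENNReal.ofReal (Real.sqrt ((2 - x)/(2 + x)) / (2*π))

/-- The mixture `μ_g = |g| 𝒟(2,-2) + (1-|g|) Arcsine`. -/
def mugMix (g : ℝ) : Measure ℝ :=
  ENNReal.ofReal |g| • Dhard + ENNReal.ofReal (1 - |g|) • ArcsineM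

/-- The mixture `ρ_g = |g| SC + (1-|g|) Arcsine`. -/
def rhog (g : ℝ) : Measure ℝ :=
  ENNReal.ofReal |g| • SCm + ENNReal.ofReal (1 - |g|) • ArcsineM

def Cg (g : ℝ) : ℝ :=
  -|g| * (1 - Real.log 2) + 1 - Real.sqrt (1 - g^2) + Real.log ((1 + Real.sqrt (1 - g^2))/2)

/-- The measure with density `(1/2π)(2+x)^{3/2}(2-x)^{1/2}` on `[-2,2]`. -/
def muHat : Measure ℝ :=
  volume.withDensity fun x =>
    ENNReal.ofReal ((2 + x) * Real.sqrt (2 + x) * Real.sqrt (2 - x) / (2*π))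

/-- The Poisson kernel measure `Pois(ζ)`, in angle coordinates. -/
def PoisM (ζ : ℂ) : Measure ℝ :=
  volume.withDensity fun θ => ENNReal.ofReal (
    if 0 ≤ θ ∧ θ < 2*π then (1 - ‖ζ‖^2)/(2*π*‖ctheta θ - ζ‖^2) else 0)

/-- The Carathéodory function of a measure on the circle (angle coordinates). -/
def Cara (ν : Measure ℝ) (z : ℂ) : ℂ := ∫ θ, (ctheta θ + z)/(ctheta θ - z) ∂ν

/-- `f` is the Schur function of `ν`. -/
def IsSchurFn (ν : Measure ℝ) (f : ℂ → ℂ) : Prop :=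
  DifferentiableOn ℂ f (Metric.ball 0 1) ∧
  (∀ z ∈ Metric.ball (0:ℂ) 1, ‖f z‖ ≤ 1) ∧
  (∀ z ∈ Metric.ball (0:ℂ) 1, Cara ν z - 1 = z * f z * (Cara ν z + 1))

/-- Möbius transform of the unit disk. -/
def mtrans (ρ z : ℂ) : ℂ := (z - ρ)/(1 - conj ρ * z)

def npRaw (ρ : ℂ) (g : ℂ → ℂ) (z : ℂ) : ℂ :=
  ((-ρ/(‖ρ‖ : ℂ)) / mtrans ρ z) * ((g z - g ρ)/(1 - conj (g ρ) * g z))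

-- One step of the Nevanlinna–Pick algorithm at `ρ` (the removable singularity at `ρ`
-- is filled in by the limit).
open Classical in
def npStep (ρ : ℂ) (g : ℂ → ℂ) : ℂ → ℂ := fun z =>
  if z = ρ then limUnder (𝓝[≠] ρ) (npRaw ρ g) else npRaw ρ g z

def schurRaw (g : ℂ → ℂ) (z : ℂ) : ℂ := ((g z - g 0)/z)/(1 - conj (g 0) * g z)

-- One step of the classical Schur algorithm (the removable singularity at `0`
-- is filled in by the limit).
open Classical in
def schurStep (g : ℂ → ℂ) : ℂ → ℂ := fun z =>
  if z = 0 then limUnder (𝓝[≠] (0:ℂ)) (schurRaw g) else schurRaw g z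

def xdHP (d : ℝ) : ℝ := 2*(1 + 2*d - d^2)/(1+d)^2

def uKMK (d : ℝ) : ℝ := 2*Real.sqrt (1 + 2*d)/(1+d)

end SumRules

namespace SumRules

def Pm (a : ℕ → ℝ) : ℕ → ℝ[X]
  | 0 => 1
  | 1 => X
  | (n+2) => X * Pm a (n+1) - C ((a (n+1))^2) * Pm a n

def vv (a : ℕ → ℝ) : ℕ → ℝ
  | 0 => -1
  | (n+1) => (a (n+1))^2 / (1 - vv a n) - 1

def AB (v : ℕ → ℝ) : ℕ → ℂ → ℂ × ℂ
  | 0, _ => (1, 1)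
  | (n+1), w => (w * (AB v n w).1 - (v (n+1) : ℂ) * (AB v n w).2,
      (AB v n w).2 - (v (n+1) : ℂ) * (w * (AB v n w).1))

def fA (v : ℕ → ℝ) (n : ℕ) (w : ℂ) : ℂ := (AB v n w).1
def fB (v : ℕ → ℝ) (n : ℕ) (w : ℂ) : ℂ := (AB v n w).2

lemma fA_zero (v : ℕ → ℝ) (w : ℂ) : fA v 0 w = 1 := rfl
lemma fB_zero (v : ℕ → ℝ) (w : ℂ) : fB v 0 w = 1 := rfl
lemma fA_succ (v : ℕ → ℝ) (n : ℕ) (w : ℂ) :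
    fA v (n+1) w = w * fA v n w - (v (n+1) : ℂ) * fB v n w := rfl
lemma fB_succ (v : ℕ → ℝ) (n : ℕ) (w : ℂ) :
    fB v (n+1) w = fB v n w - (v (n+1) : ℂ) * (w * fA v n w) := rfl

def Xp (a v : ℕ → ℝ) : ℕ → ℝ[X]
  | 0 => 1
  | (n+1) => C ((1 + v (n+1))^2) * Xp a v n - C (v (n+1)) * (Pm a (n+1))^2

def Nn (v : ℕ → ℝ) (n : ℕ) : ℝ := ∏ k ∈ Finset.range n, (1 - (v (k+1))^2)

lemma fAB_diff (v : ℕ → ℝ) (n : ℕ) :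
    Differentiable ℂ (fA v n) ∧ Differentiable ℂ (fB v n) := by
  induction n with
  | zero =>
    constructor
    · exact differentiable_const (1:ℂ)
    · exact differentiable_const (1:ℂ)
  | succ n ih =>
    obtain ⟨h1, h2⟩ := ih
    constructor
    · have : fA v (n+1) = fun w => w * fA v n w - (v (n+1) : ℂ) * fB v n w := rfl
      rw [this]; fun_prop
    · have : fB v (n+1) = fun w => fB v n w - (v (n+1) : ℂ) * (w * fA v n w) := rfl
      rw [this]; fun_prop

lemma fA_at_zero (v : ℕ → ℝ) (h0 : v 0 = -1) (n : ℕ) :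
    fA v n 0 = -(v n : ℂ) ∧ fB v n 0 = 1 := by
  induction n with
  | zero => simp [fA_zero, fB_zero, h0]
  | succ n ih => simp [fA_succ, fB_succ, ih.2]

lemma fB_deriv (v : ℕ → ℝ) (h0 : v 0 = -1) (n : ℕ) :
    HasDerivAt (fB v n) ((∑ k ∈ Finset.range n, v (k+1) * v k : ℝ) : ℂ) 0 := by
  induction n with
  | zero =>
    have h : HasDerivAt (fB v 0) 0 0 := hasDerivAt_const (0:ℂ) (1:ℂ)
    simpa using h
  | succ n ih =>
    have hA := ((fAB_diff v n).1 0).hasDerivAt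
    have h := ih.sub (((hasDerivAt_id (0:ℂ)).mul hA).const_mul (v (n+1) : ℂ))
    refine HasDerivAt.congr_deriv (f := fB v (n+1)) h ?_
    rw [Finset.sum_range_succ]
    simp [(fA_at_zero v h0 n).1]

lemma normSq_key (s : ℝ) (A B : ℂ) :
    Complex.normSq (B - s * A) - Complex.normSq (A - s * B)
      = (1 - s^2) * (Complex.normSq B - Complex.normSq A) := by
  simp [Complex.normSq_apply]; ring

lemma fAB_disc (v : ℕ → ℝ) (hv : ∀ k, |v (k+1)| < 1) (w : ℂ) (hw : ‖w‖ ≤ 1) (n : ℕ) :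
    ‖fA v n w‖ ≤ ‖fB v n w‖ ∧ fB v n w ≠ 0 := by
  induction n with
  | zero => simp [fA_zero, fB_zero]
  | succ n ih =>
    obtain ⟨h1, h2⟩ := ih
    have hwA : ‖w * fA v n w‖ ≤ ‖fB v n w‖ := by
      rw [norm_mul]
      calc ‖w‖ * ‖fA v n w‖ ≤ 1 * ‖fB v n w‖ := by gcongr
        _ = _ := one_mul _
    constructor
    · have k := normSq_key (v (n+1)) (w * fA v n w) (fB v n w)
      rw [← fA_succ, ← fB_succ] at k
      simp only [Complex.normSq_eq_norm_sq] at k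
      have e1 : (v (n+1))^2 < 1 := by
        have := hv n; rw [← sq_abs]; nlinarith [abs_nonneg (v (n+1))]
      have : 0 ≤ ‖fB v n w‖^2 - ‖w * fA v n w‖^2 := by
        have := pow_le_pow_left₀ (norm_nonneg _) hwA 2; linarith
      have h3 : ‖fA v (n+1) w‖^2 ≤ ‖fB v (n+1) w‖^2 := by
        nlinarith [mul_nonneg (by linarith : 0 ≤ 1 - (v (n+1))^2) this]
      exact le_of_sq_le_sq h3 (norm_nonneg _)
    · intro h
      rw [fB_succ, sub_eq_zero] at h
      have h4 := congrArg norm h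
      rw [norm_mul, Complex.norm_real, Real.norm_eq_abs] at h4
      have hp : 0 < ‖fB v n w‖ := norm_pos_iff.mpr h2
      have := hv n
      nlinarith [abs_nonneg (v (n+1)), norm_nonneg (w * fA v n w)]

lemma fA_circle (v : ℕ → ℝ) (w : ℂ) (hw : ‖w‖ = 1) (n : ℕ) :
    fA v n w = w^n * conj (fB v n w) := by
  have hww : w * conj w = 1 := by rw [Complex.mul_conj, Complex.normSq_eq_norm_sq, hw]; simp
  induction n with
  | zero => simp [fA_zero, fB_zero]
  | succ n ih =>
    have h2 : w^n * conj (fA v n w) = fB v n w := by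
      rw [ih]; simp
      rw [← mul_assoc, ← mul_pow, hww, one_pow, one_mul]
    rw [fA_succ, fB_succ]
    simp only [map_sub, map_mul, Complex.conj_ofReal]
    linear_combination w * ih + (v (n+1) : ℂ) * h2
      + (v (n+1) : ℂ) * w^n * conj (fA v n w) * hww

lemma norm_fA_circle (v : ℕ → ℝ) (w : ℂ) (hw : ‖w‖ = 1) (n : ℕ) :
    ‖fA v n w‖ = ‖fB v n w‖ := by
  rw [fA_circle v w hw]; simp [hw]

lemma Z_rel (a v : ℕ → ℝ) (h0 : v 0 = -1)
    (hav : ∀ k, (a (k+1))^2 = (1 - v k) * (1 + v (k+1)))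
    (z : ℂ) (x : ℝ) (hx : (x : ℂ) * z = z^2 + 1) (n : ℕ) :
    (1 - v n : ℂ) * (z^n * ((Pm a n).eval x : ℝ)) = fA v n (z^2) + fB v n (z^2) ∧
    z^(n+1) * ((Pm a (n+1)).eval x : ℝ) = z^2 * fA v n (z^2) + fB v n (z^2) := by
  induction n with
  | zero =>
    simp only [Pm, fA_zero, fB_zero, h0, eval_one, eval_X]
    push_cast
    refine ⟨by norm_num, by linear_combination hx⟩
  | succ n ih =>
    obtain ⟨h1, h2⟩ := ih
    refine ⟨?_, ?_⟩
    · rw [h2, fA_succ, fB_succ]; ring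
    · have : (Pm a (n+1+1)) = X * Pm a (n+1) - C ((a (n+1))^2) * Pm a n := rfl
      rw [this, hav n, fA_succ, fB_succ]
      simp only [eval_sub, eval_mul, eval_X, eval_C]
      push_cast
      linear_combination (z^(n+1) * ((Pm a (n+1)).eval x : ℝ)) * hx + (z^2+1) * h2
        - (1 + v (n+1)) * z^2 * h1

lemma circ_x (z : ℂ) (hz : ‖z‖ = 1) : ((2 * z.re : ℝ) : ℂ) * z = z^2 + 1 := by
  have hww : z * conj z = 1 := by rw [Complex.mul_conj, Complex.normSq_eq_norm_sq, hz]; simp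
  have : ((2 * z.re : ℝ) : ℂ) = z + conj z := (Complex.add_conj z).symm ▸ by push_cast; rfl
  rw [this]; linear_combination hww

lemma X_circle (a v : ℕ → ℝ) (h0 : v 0 = -1)
    (hav : ∀ k, (a (k+1))^2 = (1 - v k) * (1 + v (k+1)))
    (z : ℂ) (hz : ‖z‖ = 1) (n : ℕ) :
    (Xp a v n).eval (2 * z.re) = ‖fB v n (z^2)‖^2 := by
  induction n with
  | zero => simp [Xp, fB_zero]
  | succ n ih =>
    have hw : ‖z^2‖ = 1 := by simp [hz]
    have h2 := (Z_rel a v h0 hav z (2 * z.re) (circ_x z hz) n).2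
    have h3 := congrArg Complex.normSq h2
    rw [Complex.normSq_eq_norm_sq, norm_mul, norm_pow, hz, one_pow, one_mul, Complex.norm_real,
      Real.norm_eq_abs, sq_abs] at h3
    have h4 : Complex.normSq (z^2 * fA v n (z^2)) = Complex.normSq (fB v n (z^2)) := by
      rw [Complex.normSq_eq_norm_sq, Complex.normSq_eq_norm_sq, norm_mul, hw, one_mul,
        norm_fA_circle v _ hw]
    have h5 : (Xp a v (n+1)) = C ((1 + v (n+1))^2) * Xp a v n - C (v (n+1)) * (Pm a (n+1))^2 := rfl
    rw [h5]
    simp only [eval_sub, eval_mul, eval_C, eval_pow]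
    rw [ih, h3, fB_succ, ← Complex.normSq_eq_norm_sq, ← Complex.normSq_eq_norm_sq]
    generalize z^2 * fA v n (z^2) = A at *
    generalize fB v n (z^2) = B at *
    simp only [Complex.normSq_apply, Complex.sub_re, Complex.sub_im, Complex.add_re,
      Complex.add_im, Complex.mul_re, Complex.mul_im, Complex.ofReal_re, Complex.ofReal_im] at *
    linear_combination (-(v (n+1)) - (v (n+1))^2) * h4

lemma X_D (a v : ℕ → ℝ) (h0 : v 0 = -1)
    (hav : ∀ k, (a (k+1))^2 = (1 - v k) * (1 + v (k+1))) (x : ℝ) (n : ℕ) :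
    (4 - x^2) * (Xp a v n).eval x = ((Pm a (n+1)).eval x)^2
      + (1 - v n)^2 * ((Pm a n).eval x)^2
      - (1 - v n) * (x * (Pm a n).eval x * (Pm a (n+1)).eval x) := by
  induction n with
  | zero => simp [Xp, Pm, h0]; ring
  | succ n ih =>
    have h5 : (Xp a v (n+1)) = C ((1 + v (n+1))^2) * Xp a v n - C (v (n+1)) * (Pm a (n+1))^2 := rfl
    have h6 : (Pm a (n+1+1)) = X * Pm a (n+1) - C ((a (n+1))^2) * Pm a n := rfl
    rw [h5, h6, hav n]
    simp only [eval_sub, eval_mul, eval_X, eval_C, eval_pow]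
    linear_combination (1 + v (n+1))^2 * ih

lemma ca_re (h : ℂ → ℂ) (hh : ∀ z ∈ Metric.closedBall (0:ℂ) 1, DifferentiableAt ℂ h z) :
    circleAverage (fun z => (h z).re) 0 1 = (h 0).re := by
  have hd : DiffContOnCl ℂ h (Metric.ball 0 |(1:ℝ)|) := by
    apply DifferentiableOn.diffContOnCl
    intro z hz
    apply (hh z _).differentiableWithinAt
    simpa [closure_ball] using hz
  have h1 := hd.circleAverage
  have hc : CircleIntegrable h 0 1 := by
    apply ContinuousOn.circleIntegrable (by norm_num)
    intro z hz
    exact (hh z (Metric.sphere_subset_closedBall hz)).continuousAt.continuousWithinAt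
  have h2 := Complex.reCLM.circleAverage_comp_comm hc
  rw [← h1]
  simpa [Function.comp_def] using h2

lemma meanlog (B : ℂ → ℂ) (hB : Differentiable ℂ B) (hne : ∀ w, ‖w‖ ≤ 1 → B w ≠ 0)
    (hB0 : B 0 = 1) (c : ℂ) (hc : HasDerivAt B c 0) (γ : ℝ) :
    circleAverage (fun z => Real.log (‖B (z^2)‖^2) * (1 - γ * (z^2).re)) 0 1 = - γ * c.re := by
  obtain ⟨R, hR, hRB⟩ : ∃ R > (1:ℝ), ∀ w ∈ Metric.ball (0:ℂ) R, B w ≠ 0 := by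
    have ho : IsOpen {w | B w ≠ 0} := isOpen_ne_fun hB.continuous continuous_const
    have hs : Metric.closedBall (0:ℂ) 1 ⊆ {w | B w ≠ 0} := fun w hw => hne w (by simpa using hw)
    obtain ⟨δ, hδ, h⟩ := (isCompact_closedBall (0:ℂ) 1).exists_thickening_subset_open ho hs
    refine ⟨1 + δ, by linarith, fun w hw => h ?_⟩
    rw [thickening_closedBall hδ (by norm_num)]
    rwa [add_comm]
  have hex : Complex.IsExactOn (fun w => deriv B w / B w) (Metric.ball 0 R) := by
    apply DifferentiableOn.isExactOn_ball
    exact (hB.contDiff.differentiable_deriv_two).differentiableOn.div hB.differentiableOn hRB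
  obtain ⟨F, hF0, hF⟩ := hex.with_val_at 0 0
  have hR0 : (0:ℂ) ∈ Metric.ball (0:ℂ) R := Metric.mem_ball_self (by linarith)
  have hexp : ∀ w ∈ Metric.ball (0:ℂ) R, B w = Complex.exp (F w) := by
    have hd : ∀ w ∈ Metric.ball (0:ℂ) R, HasDerivAt (fun w => B w * Complex.exp (-F w)) 0 w := by
      intro w hw
      have := (hB w).hasDerivAt.mul ((hF w hw).neg.cexp)
      refine this.congr_deriv ?_
      have := hRB w hw
      field_simp
      simp
    have hconst := fun w hw => (convex_ball (0:ℂ) R).is_const_of_fderivWithin_eq_zero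
      (𝕜 := ℂ) (f := fun w => B w * Complex.exp (-F w))
      (fun w hw => (hd w hw).differentiableAt.differentiableWithinAt)
      (fun w hw => by
        rw [fderivWithin_of_isOpen Metric.isOpen_ball hw]
        ext; simp [(hd w hw).deriv]) (x := w) (y := 0) hw hR0
    intro w hw
    have h1 := hconst w hw
    simp only [hF0, hB0, neg_zero, Complex.exp_zero, mul_one] at h1
    rw [Complex.exp_neg] at h1
    have := Complex.exp_ne_zero (F w)
    field_simp at h1
    exact h1
  set G := dslope F 0 with hG
  have hFd : DifferentiableOn ℂ F (Metric.ball 0 R) :=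
    fun w hw => (hF w hw).differentiableAt.differentiableWithinAt
  have hGd : DifferentiableOn ℂ G (Metric.ball 0 R) :=
    (Complex.differentiableOn_dslope (Metric.isOpen_ball.mem_nhds hR0)).2 hFd
  have hFG : ∀ w, F w = w * G w := by
    intro w
    have := sub_smul_dslope F 0 w
    simp only [sub_zero, smul_eq_mul, hF0] at this
    exact this.symm
  have hG0 : G 0 = c := by
    rw [hG, dslope_same, (hF 0 hR0).deriv, hB0, hc.deriv, div_one]
  have hin : ∀ z ∈ Metric.closedBall (0:ℂ) 1, z^2 ∈ Metric.ball (0:ℂ) R := by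
    intro z hz
    simp only [Metric.mem_closedBall, dist_zero_right, Metric.mem_ball, norm_pow] at hz ⊢
    nlinarith [norm_nonneg z]
  have key := ca_re (fun z => 2 * F (z^2) - γ * (F (z^2) * z^2 + G (z^2))) (by
    intro z hz
    have h1 : DifferentiableAt ℂ (fun z : ℂ => F (z^2)) z :=
      DifferentiableAt.comp z (hF _ (hin z hz)).differentiableAt (by fun_prop)
    have h2 : DifferentiableAt ℂ (fun z : ℂ => G (z^2)) z :=
      DifferentiableAt.comp z
        (hGd.differentiableAt (Metric.isOpen_ball.mem_nhds (hin z hz))) (by fun_prop)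
    have h3 : DifferentiableAt ℂ (fun z : ℂ => z^2) z := by fun_prop
    exact (h1.const_mul 2).sub (((h1.mul h3).add h2).const_mul _))
  have e : circleAverage (fun z => Real.log (‖B (z^2)‖^2) * (1 - γ * (z^2).re)) 0 1
      = circleAverage (fun z => (2 * F (z^2) - γ * (F (z^2) * z^2 + G (z^2))).re) 0 1 := by
    apply circleAverage_congr_sphere
    intro z hz
    simp only [abs_one] at hz
    have hz' := hin z (Metric.sphere_subset_closedBall hz)
    have hz1 : ‖z^2‖ = 1 := by
      simp only [mem_sphere_iff_norm, sub_zero] at hz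
      simp [hz]
    have hww : conj (z^2) * z^2 = 1 := by
      rw [mul_comm, Complex.mul_conj, Complex.normSq_eq_norm_sq, hz1]; simp
    have hGc : G (z^2) = conj (z^2) * F (z^2) := by
      rw [hFG (z^2), ← mul_assoc, hww, one_mul]
    dsimp only
    rw [hexp _ hz', Complex.norm_exp, ← Real.exp_nat_mul, Real.log_exp, hGc]
    generalize z^2 = w
    simp [Complex.mul_re]
    ring
  rw [e, key]
  simp [hF0, hG0]

def Lam (v : ℕ → ℝ) (n : ℕ) (Q : ℝ[X]) : ℝ :=
  circleAverage (fun z => Q.eval (2 * z.re) / ‖fB v n (z^2)‖^2) 0 1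

lemma ci_cont (f : ℂ → ℝ) (hf : ContinuousOn f (Metric.sphere 0 1)) : CircleIntegrable f 0 1 :=
  ContinuousOn.circleIntegrable (by norm_num) hf

lemma fB_ne (v : ℕ → ℝ) (hv : ∀ k, |v (k+1)| < 1) (n : ℕ) (z : ℂ) (hz : ‖z‖ ≤ 1) :
    fB v n (z^2) ≠ 0 :=
  (fAB_disc v hv (z^2) (by rw [norm_pow]; exact pow_le_one₀ (norm_nonneg _) hz) n).2

lemma Lam_ci (v : ℕ → ℝ) (hv : ∀ k, |v (k+1)| < 1) (n : ℕ) (Q : ℝ[X]) :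
    CircleIntegrable (fun z => Q.eval (2 * z.re) / ‖fB v n (z^2)‖^2) 0 1 := by
  apply ci_cont
  have hB := (fAB_diff v n).2.continuous
  apply ContinuousOn.div
  · exact (Q.continuous.comp (by fun_prop)).continuousOn
  · fun_prop
  · intro z hz
    have hz' : ‖z‖ = 1 := by simpa using hz
    have := fB_ne v hv n z hz'.le
    positivity

lemma Lam_sub (v : ℕ → ℝ) (hv : ∀ k, |v (k+1)| < 1) (n : ℕ) (Q R : ℝ[X]) :
    Lam v n (Q - R) = Lam v n Q - Lam v n R := by
  unfold Lam
  rw [← circleAverage_fun_sub (Lam_ci v hv n Q) (Lam_ci v hv n R)]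
  congr 1; ext z; simp [sub_div]

lemma Lam_C (v : ℕ → ℝ) (n : ℕ) (c : ℝ) (Q : ℝ[X]) :
    Lam v n (C c * Q) = c * Lam v n Q := by
  unfold Lam
  show _ = c • (_ : ℝ)
  rw [← circleAverage_fun_smul]
  congr 1; ext z; simp [mul_div_assoc]

lemma Lam_gen (v : ℕ → ℝ) (hv : ∀ k, |v (k+1)| < 1) (h0 : v 0 = -1) (n m i : ℕ) (hi : i ≤ m)
    (Q : ℝ[X]) (c : ℝ)
    (hQ : ∀ z : ℂ, ‖z‖ = 1 → c * Q.eval (2 * z.re) = 2 * (z^m * conj (fB v n (z^2))).re) :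
    c * Lam v n (Q * X^i) = 2 * 0^(m-i) := by
  rw [← Lam_C]
  have key := ca_re (fun z => 2 * z^(m-i) * (z^2+1)^i / fB v n (z^2)) (by
    intro z hz
    have hB := (fAB_diff v n).2
    have := fB_ne v hv n z (by simpa using hz)
    have hd : DifferentiableAt ℂ (fun z => fB v n (z^2)) z := by fun_prop
    exact DifferentiableAt.fun_div (by fun_prop) hd this)
  have e : Lam v n (C c * (Q * X^i)) =
      circleAverage (fun z => (2 * z^(m-i) * (z^2+1)^i / fB v n (z^2)).re) 0 1 := by
    apply circleAverage_congr_sphere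
    intro z hz
    have hz1 : ‖z‖ = 1 := by simpa using hz
    have hne := fB_ne v hv n z hz1.le
    dsimp only
    have h1 : (2 * z^(m-i) * (z^2+1)^i / fB v n (z^2))
        = (((2 * z.re)^i / ‖fB v n (z^2)‖^2 : ℝ) : ℂ) * (2 * (z^m * conj (fB v n (z^2)))) := by
      rw [← circ_x z hz1, mul_pow, div_eq_mul_inv, Complex.inv_def, Complex.normSq_eq_norm_sq]
      have : z^m = z^(m-i) * z^i := by rw [← pow_add]; congr 1; omega
      rw [this]
      push_cast
      ring
    rw [h1, Complex.re_ofReal_mul]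
    have h2 := hQ z hz1
    have h3 : (2 * (z^m * conj (fB v n (z^2)))).re = 2 * (z^m * conj (fB v n (z^2))).re := by
      simp [Complex.mul_re]
    rw [h3, ← h2]
    simp only [eval_mul, eval_C, eval_pow, eval_X]
    ring
  rw [e, key]
  simp [(fA_at_zero v h0 n).2]
  rw [← Complex.ofReal_zero, ← Complex.ofReal_pow, Complex.ofReal_re]

lemma conj_pow_mul (z : ℂ) (hz : ‖z‖ = 1) (m : ℕ) : conj (z^m) * z^m = 1 := by
  rw [mul_comm, Complex.mul_conj, Complex.normSq_eq_norm_sq, norm_pow, hz]; simp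

lemma re_aux (q : ℝ) (u s : ℂ) (hu : conj u * u = 1) (h : u * q = u * u * s + conj s) :
    q = 2 * (u * s).re := by
  have : (q : ℂ) = u * s + conj (u * s) := by
    rw [map_mul]
    linear_combination conj u * h + (u * s - q) * hu
  rw [Complex.add_conj] at this
  exact_mod_cast this

lemma Lam_n (a v : ℕ → ℝ) (h0 : v 0 = -1) (hv : ∀ k, |v (k+1)| < 1)
    (hav : ∀ k, (a (k+1))^2 = (1 - v k) * (1 + v (k+1))) (n i : ℕ) (hi : i ≤ n) :
    (1 - v n) * Lam v n (Pm a n * X^i) = 2 * 0^(n-i) := by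
  apply Lam_gen v hv h0 n n i hi
  intro z hz
  have h1 := (Z_rel a v h0 hav z (2 * z.re) (circ_x z hz) n).1
  rw [fA_circle v (z^2) (by simp [hz]) n] at h1
  apply re_aux _ _ _ (conj_pow_mul z hz n)
  simp only [Complex.conj_conj]
  push_cast at h1 ⊢
  rw [← pow_mul] at h1
  linear_combination h1

lemma Lam_n1 (a v : ℕ → ℝ) (h0 : v 0 = -1) (hv : ∀ k, |v (k+1)| < 1)
    (hav : ∀ k, (a (k+1))^2 = (1 - v k) * (1 + v (k+1))) (n i : ℕ) (hi : i ≤ n) :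
    Lam v n (Pm a (n+1) * X^i) = 0 := by
  have := Lam_gen v hv h0 n (n+1) i (by omega) (Pm a (n+1)) 1 (by
    intro z hz
    have h1 := (Z_rel a v h0 hav z (2 * z.re) (circ_x z hz) n).2
    rw [fA_circle v (z^2) (by simp [hz]) n] at h1
    apply re_aux _ _ _ (conj_pow_mul z hz (n+1))
    simp only [Complex.conj_conj]
    push_cast at h1 ⊢
    rw [← pow_mul] at h1
    linear_combination h1)
  rw [one_mul] at this
  rw [this]
  have : n + 1 - i ≠ 0 := by omega
  simp [this]

def Pi2 (a : ℕ → ℝ) (n : ℕ) : ℝ := ∏ k ∈ Finset.range n, (a (k+1))^2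

lemma Pi2_N (a v : ℕ → ℝ) (h0 : v 0 = -1)
    (hav : ∀ k, (a (k+1))^2 = (1 - v k) * (1 + v (k+1))) (n : ℕ) :
    Pi2 a n * (1 - v n) = 2 * Nn v n := by
  induction n with
  | zero => simp [Pi2, Nn, h0]; norm_num
  | succ n ih =>
    have e1 : Pi2 a (n+1) = Pi2 a n * (a (n+1))^2 := Finset.prod_range_succ _ _
    have e2 : Nn v (n+1) = Nn v n * (1 - (v (n+1))^2) := Finset.prod_range_succ _ _
    rw [e1, e2, hav n]
    linear_combination (1 - (v (n+1))^2) * ih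

lemma Lam_all (a v : ℕ → ℝ) (h0 : v 0 = -1) (hv : ∀ k, |v (k+1)| < 1)
    (hav : ∀ k, (a (k+1))^2 = (1 - v k) * (1 + v (k+1))) (hv1 : ∀ k, 0 < 1 - v k)
    (ha : ∀ k, 0 < (a (k+1))^2) (n : ℕ) (d : ℕ) :
    ∀ k, k + d = n → (∀ i < k, Lam v n (Pm a k * X^i) = 0) ∧
      (∀ i < k+1, Lam v n (Pm a (k+1) * X^i) = 0) ∧
      Nn v n * Lam v n (Pm a k * X^k) = Pi2 a k := by
  induction d with
  | zero =>
    intro k hk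
    obtain rfl : k = n := by omega
    have hne := (hv1 k).ne'
    refine ⟨fun i hi => ?_, fun i hi => Lam_n1 a v h0 hv hav k i (by omega), ?_⟩
    · have := Lam_n a v h0 hv hav k i hi.le
      have h2 : k - i ≠ 0 := by omega
      simp [h2, hne] at this
      exact this
    · have := Lam_n a v h0 hv hav k k le_rfl
      have h3 := Pi2_N a v h0 hav k
      simp only [Nat.sub_self, pow_zero, mul_one] at this
      apply mul_right_cancel₀ hne
      rw [h3]
      linear_combination Nn v k * this
  | succ d ih =>
    intro k hk
    obtain ⟨i1, i2, i3⟩ := ih (k+1) (by omega)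
    have hne := (ha k).ne'
    have hrec : ∀ i, (a (k+1))^2 * Lam v n (Pm a k * X^i)
        = Lam v n (Pm a (k+1) * X^(i+1)) - Lam v n (Pm a (k+1+1) * X^i) := by
      intro i
      rw [← Lam_C, ← Lam_sub v hv]
      congr 1
      have : (Pm a (k+1+1)) = X * Pm a (k+1) - C ((a (k+1))^2) * Pm a k := rfl
      rw [this]; ring
    refine ⟨fun i hi => ?_, fun i hi => i1 i hi, ?_⟩
    · have := hrec i
      rw [i1 (i+1) (by omega), i2 i (by omega), sub_zero] at this
      simpa [hne] using this
    · have := hrec k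
      rw [i2 k (by omega), sub_zero] at this
      have e1 : Pi2 a (k+1) = Pi2 a k * (a (k+1))^2 := Finset.prod_range_succ _ _
      rw [e1] at i3
      apply mul_right_cancel₀ hne
      rw [← i3]
      linear_combination Nn v n * this

lemma Lam_P (a v : ℕ → ℝ) (h0 : v 0 = -1) (hv : ∀ k, |v (k+1)| < 1)
    (hav : ∀ k, (a (k+1))^2 = (1 - v k) * (1 + v (k+1))) (hv1 : ∀ k, 0 < 1 - v k)
    (ha : ∀ k, 0 < (a (k+1))^2) (n k : ℕ) (hk : k ≤ n) :
    Nn v n * Lam v n (Pm a k) = if k = 0 then 1 else 0 := by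
  obtain ⟨h1, _, h3⟩ := Lam_all a v h0 hv hav hv1 ha n (n-k) k (by omega)
  split_ifs with h
  · subst h; simpa [Pi2] using h3
  · have := h1 0 (by omega)
    rw [pow_zero, mul_one] at this
    rw [this, mul_zero]

lemma int_cont (μ : Measure ℝ) [IsFiniteMeasure μ] (hsupp : μ (Icc (-2) 2)ᶜ = 0) (f : ℝ → ℝ)
    (hf : Continuous f) : Integrable f μ := by
  have h : μ.restrict (Icc (-2) 2) = μ := Measure.restrict_eq_self_of_ae_mem (by
    rw [ae_iff]; exact hsupp)
  have := hf.continuousOn.integrableOn_compact (μ := μ) (isCompact_Icc (a := (-2:ℝ)) (b := 2))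
  rwa [IntegrableOn, h] at this

lemma int_poly (μ : Measure ℝ) [IsFiniteMeasure μ] (hsupp : μ (Icc (-2) 2)ᶜ = 0) (Q : ℝ[X]) :
    Integrable (fun x => Q.eval x) μ := int_cont μ hsupp _ Q.continuous

def Orth (μ : Measure ℝ) (a : ℕ → ℝ) : Prop :=
  (∀ k, 0 < a (k+1)) ∧ (∀ k, (Pm a k).natDegree = k) ∧
  (∀ j k, ∫ x, (Pm a j * Pm a k).eval x ∂μ = if j = k then Pi2 a k else 0)

lemma orth_of_jac (μ : Measure ℝ) [IsProbabilityMeasure μ] (a b : ℕ → ℝ) (hab : IsJacobi μ a b)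
    (hb : ∀ k : ℕ, b (k+1) = 0) : Orth μ a := by
  obtain ⟨ha, p, hdeg, hlc, horth, hrec⟩ := hab
  set D : ℕ → ℝ := fun k => ∏ j ∈ Finset.range k, a (j+1) with hD
  have hDs : ∀ k, D (k+1) = D k * a (k+1) := fun k => Finset.prod_range_succ _ _
  have hD0 : D 0 = 1 := by simp [hD]
  have hDpos : ∀ k, 0 < D k := fun k => Finset.prod_pos (fun j _ => ha j)
  have hD2 : ∀ k, D k ^ 2 = Pi2 a k := by
    intro k; simp only [hD, Pi2]; rw [Finset.prod_pow]
  have hp0 : ∀ x, (p 0).eval x = 1 := by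
    have h1 := Polynomial.eq_C_of_natDegree_eq_zero (hdeg 0)
    have h2 := hlc 0
    have h3 := horth 0 0
    generalize (p 0).coeff 0 = c at h1
    rw [h1] at h2 h3
    simp at h2 h3
    have : c = 1 := by nlinarith
    intro x; rw [h1, this]; simp
  have key : ∀ k, (Pm a k = C (D k) * p k) ∧ (Pm a (k+1) = C (D (k+1)) * p (k+1)) := by
    intro k
    induction k with
    | zero =>
      constructor
      · apply Polynomial.funext; intro x; simp [Pm, hp0, hD0]
      · apply Polynomial.funext; intro x
        have := hrec 0 x
        simp [hb, hp0] at this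
        rw [hDs, hD0]
        simp only [Pm, eval_mul, eval_C, eval_X, one_mul]
        simpa using this
    | succ k ih =>
      refine ⟨ih.2, ?_⟩
      have e : Pm a (k+1+1) = X * Pm a (k+1) - C ((a (k+1))^2) * Pm a k := rfl
      apply Polynomial.funext; intro x
      have h := hrec (k+1) x
      simp [hb] at h
      rw [e, ih.1, ih.2]
      simp only [eval_sub, eval_mul, eval_X, eval_C, hDs]
      linear_combination (D k * a (k+1)) * h
  have key' := fun k => (key k).1
  refine ⟨ha, fun k => ?_, fun j k => ?_⟩
  · rw [key' k, natDegree_C_mul (hDpos k).ne', hdeg]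
  · rw [key' j, key' k]
    have : (fun x => (C (D j) * p j * (C (D k) * p k)).eval x)
        = fun x => (D j * D k) * ((p j).eval x * (p k).eval x) := by
      ext x; simp; ring
    rw [this, integral_const_mul, horth]
    split_ifs with h
    · subst h; rw [← hD2]; ring
    · simp

def Kp (a : ℕ → ℝ) : ℕ → ℝ[X]
  | 0 => 1
  | (k+1) => Kp a k + C ((Pm a (k+1)).eval 2 / Pi2 a (k+1)) * Pm a (k+1)

lemma Pi2_succ (a : ℕ → ℝ) (k : ℕ) : Pi2 a (k+1) = Pi2 a k * (a (k+1))^2 :=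
  Finset.prod_range_succ _ _

lemma Pi2_pos (a : ℕ → ℝ) (ha : ∀ k, 0 < a (k+1)) (k : ℕ) : 0 < Pi2 a k :=
  Finset.prod_pos (fun j _ => pow_pos (ha j) 2)

lemma CD (a : ℕ → ℝ) (ha : ∀ k, 0 < a (k+1)) (k : ℕ) (x : ℝ) :
    (2 - x) * (Kp a k).eval x * Pi2 a k
      = (Pm a (k+1)).eval 2 * (Pm a k).eval x - (Pm a k).eval 2 * (Pm a (k+1)).eval x := by
  induction k with
  | zero => simp [Kp, Pi2, Pm]
  | succ k ih =>
    have hp := (Pi2_pos a ha (k+1)).ne'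
    have hp' := (Pi2_pos a ha k).ne'
    have e : Pm a (k+1+1) = X * Pm a (k+1) - C ((a (k+1))^2) * Pm a k := rfl
    have e2 : Kp a (k+1) = Kp a k + C ((Pm a (k+1)).eval 2 / Pi2 a (k+1)) * Pm a (k+1) := rfl
    rw [e, e2]
    simp only [eval_add, eval_sub, eval_mul, eval_X, eval_C]
    have : (2 - x) * ((Kp a k).eval x + (Pm a (k+1)).eval 2 / Pi2 a (k+1) * (Pm a (k+1)).eval x)
        * Pi2 a (k+1) = (2-x) * (Kp a k).eval x * Pi2 a (k+1)
          + (2-x) * (Pm a (k+1)).eval 2 * (Pm a (k+1)).eval x := by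
      field_simp
    rw [this, Pi2_succ]
    linear_combination (a (k+1))^2 * ih

lemma K_orth (μ : Measure ℝ) [IsProbabilityMeasure μ] (hsupp : μ (Icc (-2) 2)ᶜ = 0) (a : ℕ → ℝ)
    (ho : Orth μ a) (k m : ℕ) (hm : k < m) :
    ∫ x, (Pm a m * Kp a k).eval x ∂μ = 0 := by
  induction k with
  | zero =>
    have := ho.2.2 m 0
    simpa [Pm, Kp, hm.ne'] using this
  | succ k ih =>
    have e2 : Kp a (k+1) = Kp a k + C ((Pm a (k+1)).eval 2 / Pi2 a (k+1)) * Pm a (k+1) := rfl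
    have : (fun x => (Pm a m * Kp a (k+1)).eval x) = fun x => (Pm a m * Kp a k).eval x
        + ((Pm a (k+1)).eval 2 / Pi2 a (k+1)) * (Pm a m * Pm a (k+1)).eval x := by
      ext x; rw [e2]; simp; ring
    rw [this, integral_add (int_poly μ hsupp _) ((int_poly μ hsupp _).const_mul _),
      ih (by omega), integral_const_mul, ho.2.2]
    simp [hm.ne']

lemma K_diag (μ : Measure ℝ) [IsProbabilityMeasure μ] (hsupp : μ (Icc (-2) 2)ᶜ = 0) (a : ℕ → ℝ)
    (ho : Orth μ a) (k : ℕ) :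
    ∫ x, (Pm a k * Kp a k).eval x ∂μ = (Pm a k).eval 2 := by
  cases k with
  | zero => simp [Pm, Kp]
  | succ k =>
    have e2 : Kp a (k+1) = Kp a k + C ((Pm a (k+1)).eval 2 / Pi2 a (k+1)) * Pm a (k+1) := rfl
    have : (fun x => (Pm a (k+1) * Kp a (k+1)).eval x) = fun x => (Pm a (k+1) * Kp a k).eval x
        + ((Pm a (k+1)).eval 2 / Pi2 a (k+1)) * (Pm a (k+1) * Pm a (k+1)).eval x := by
      ext x; rw [e2]; simp; ring
    have hp := (Pi2_pos a ho.1 (k+1)).ne'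
    rw [this, integral_add (int_poly μ hsupp _) ((int_poly μ hsupp _).const_mul _),
      K_orth μ hsupp a ho k _ (by omega), integral_const_mul, ho.2.2]
    simp; field_simp

lemma Pm_pos (μ : Measure ℝ) [IsProbabilityMeasure μ] (hsupp : μ (Icc (-2) 2)ᶜ = 0) (a : ℕ → ℝ)
    (ho : Orth μ a) (k : ℕ) : 0 < (Pm a k).eval 2 := by
  induction k with
  | zero => simp [Pm]
  | succ k ih =>
    have hp := (Pi2_pos a ho.1 k)
    set Q : ℝ[X] := (C 2 - X) * (Kp a k)^2 with hQ
    have hae : ∀ᵐ x ∂μ, x ∈ Icc (-2:ℝ) 2 := by rw [ae_iff]; exact hsupp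
    have hnn : 0 ≤ᵐ[μ] fun x => Q.eval x := by
      filter_upwards [hae] with x hx
      simp only [hQ, eval_mul, eval_sub, eval_X, eval_pow, Pi.zero_apply]
      have : (0:ℝ) ≤ 2 - x := by linarith [hx.2]
      rw [eval_C]
      positivity
    have hQe : ∀ x, Q.eval x = (2 - x) * (Kp a k).eval x ^ 2 := by
      intro x
      simp only [hQ, eval_mul, eval_sub, eval_X, eval_pow, eval_C]
    have hI : (∫ x, Q.eval x ∂μ) * Pi2 a k = (Pm a (k+1)).eval 2 * (Pm a k).eval 2 := by
      rw [← integral_mul_const]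
      have : (fun x => Q.eval x * Pi2 a k) = fun x =>
          (Pm a (k+1)).eval 2 * (Pm a k * Kp a k).eval x
          - (Pm a k).eval 2 * (Pm a (k+1) * Kp a k).eval x := by
        ext x
        rw [hQe]
        simp only [eval_mul]
        linear_combination (Kp a k).eval x * CD a ho.1 k x
      rw [this, integral_sub ((int_poly μ hsupp _).const_mul _) ((int_poly μ hsupp _).const_mul _),
        integral_const_mul, integral_const_mul, K_diag μ hsupp a ho,
        K_orth μ hsupp a ho k _ (by omega)]
      ring
    have h1 : 0 ≤ ∫ x, Q.eval x ∂μ := integral_nonneg_of_ae hnn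
    have h2 : 0 ≤ (Pm a (k+1)).eval 2 := by
      by_contra h
      push Not at h
      nlinarith [mul_nonneg h1 hp.le, mul_neg_of_neg_of_pos h ih]
    rcases h2.lt_or_eq with h | h
    · exact h
    exfalso
    rw [← h, zero_mul] at hI
    have h3 : ∫ x, Q.eval x ∂μ = 0 := by
      rcases mul_eq_zero.1 hI with h | h
      · exact h
      · exact absurd h hp.ne'
    rw [integral_eq_zero_iff_of_nonneg_ae hnn (int_poly μ hsupp _)] at h3
    have h4 : ∫ x, (Pm a (k+1) * Pm a (k+1)).eval x ∂μ = 0 := by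
      apply integral_eq_zero_of_ae
      filter_upwards [h3] with x hx
      rw [hQe] at hx
      have h5 := CD a ho.1 k x
      have h6 : (2 - x) * (Kp a k).eval x = 0 := by
        rcases mul_eq_zero.1 hx with h | h
        · simp [h]
        · simp [pow_eq_zero_iff (two_ne_zero)] at h; simp [h]
      rw [h6, ← h, zero_mul, zero_mul, zero_sub, eq_comm, neg_eq_zero] at h5
      rcases mul_eq_zero.1 h5 with h | h
      · exact absurd h ih.ne'
      · simp [h]
    rw [ho.2.2] at h4
    simp at h4
    exact (Pi2_pos a ho.1 (k+1)).ne' h4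

lemma vv_facts (μ : Measure ℝ) [IsProbabilityMeasure μ] (hsupp : μ (Icc (-2) 2)ᶜ = 0) (a : ℕ → ℝ)
    (ho : Orth μ a) : (∀ k, 0 < 1 - vv a k) ∧ (∀ k, |vv a (k+1)| < 1) ∧
      (∀ k, (a (k+1))^2 = (1 - vv a k) * (1 + vv a (k+1))) := by
  have hP := Pm_pos μ hsupp a ho
  have e0 : vv a 0 = -1 := rfl
  have e1 : ∀ k, vv a (k+1) = (a (k+1))^2 / (1 - vv a k) - 1 := fun k => rfl
  have h1 : ∀ k, (1 - vv a k) * (Pm a k).eval 2 = (Pm a (k+1)).eval 2 ∧ 0 < 1 - vv a k := by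
    intro k
    induction k with
    | zero => rw [e0]; simp [Pm]; norm_num
    | succ k ih =>
      have e : Pm a (k+1+1) = X * Pm a (k+1) - C ((a (k+1))^2) * Pm a k := rfl
      have hne := ih.2.ne'
      have : (1 - vv a (k+1)) * (Pm a (k+1)).eval 2 = (Pm a (k+1+1)).eval 2 := by
        rw [e1, e, ← ih.1]
        simp only [eval_sub, eval_mul, eval_X, eval_C, ← ih.1]
        field_simp
        ring
      refine ⟨this, ?_⟩
      have h3 := hP (k+1+1)
      rw [← this] at h3
      exact (pos_iff_pos_of_mul_pos h3).2 (hP (k+1))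
  refine ⟨fun k => (h1 k).2, fun k => ?_, fun k => ?_⟩
  · have h2 := (h1 (k+1)).2
    have h3 := (h1 k).2
    have h4 := ho.1 k
    have : 0 < (a (k+1))^2 / (1 - vv a k) := by positivity
    rw [abs_lt]
    constructor
    · rw [e1]; linarith
    · linarith
  · have h3 := (h1 k).2.ne'
    rw [e1]; field_simp; ring

lemma Nn_succ (v : ℕ → ℝ) (n : ℕ) : Nn v (n+1) = Nn v n * (1 - (v (n+1))^2) :=
  Finset.prod_range_succ _ _

lemma Pi2_N' (a v : ℕ → ℝ) (h0 : v 0 = -1)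
    (hav : ∀ k, (a (k+1))^2 = (1 - v k) * (1 + v (k+1))) (n : ℕ) :
    Pi2 a (n+1) = 2 * Nn v n * (1 + v (n+1)) := by
  rw [Pi2_succ, hav, ← Pi2_N a v h0 hav n]; ring

lemma int_X (μ : Measure ℝ) [IsProbabilityMeasure μ] (hsupp : μ (Icc (-2) 2)ᶜ = 0) (a v : ℕ → ℝ)
    (ho : Orth μ a) (h0 : v 0 = -1)
    (hav : ∀ k, (a (k+1))^2 = (1 - v k) * (1 + v (k+1))) (n : ℕ) :
    ∫ x, (Xp a v n).eval x ∂μ = Nn v n := by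
  induction n with
  | zero => simp [Xp, Nn]
  | succ n ih =>
    have e : Xp a v (n+1) = C ((1 + v (n+1))^2) * Xp a v n - C (v (n+1)) * (Pm a (n+1))^2 := rfl
    have : (fun x => (Xp a v (n+1)).eval x) = fun x => (1 + v (n+1))^2 * (Xp a v n).eval x
        - v (n+1) * (Pm a (n+1) * Pm a (n+1)).eval x := by
      ext x; rw [e]; simp only [eval_mul, eval_sub, eval_pow, eval_C]; ring
    rw [this, integral_sub ((int_poly μ hsupp _).const_mul _) ((int_poly μ hsupp _).const_mul _),
        integral_const_mul, integral_const_mul, ih, ho.2.2, if_pos rfl, Nn_succ,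
        Pi2_N' a v h0 hav]
    ring

lemma int_xPP (μ : Measure ℝ) [IsProbabilityMeasure μ] (hsupp : μ (Icc (-2) 2)ᶜ = 0) (a : ℕ → ℝ)
    (ho : Orth μ a) (n : ℕ) :
    ∫ x, (X * Pm a n * Pm a (n+1)).eval x ∂μ = Pi2 a (n+1) := by
  cases n with
  | zero =>
    have := ho.2.2 1 1
    simpa [Pm] using this
  | succ n =>
    have e : Pm a (n+1+1) = X * Pm a (n+1) - C ((a (n+1))^2) * Pm a n := rfl
    have : (fun x => (X * Pm a (n+1) * Pm a (n+1+1)).eval x) =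
        fun x => (Pm a (n+1+1) * Pm a (n+1+1)).eval x
          + (a (n+1))^2 * (Pm a n * Pm a (n+1+1)).eval x := by
      ext x; rw [e]; simp; ring
    rw [this, integral_add ((int_poly μ hsupp _)) ((int_poly μ hsupp _).const_mul _),
        integral_const_mul, ho.2.2, ho.2.2, if_pos rfl, if_neg (by omega)]
    simp

lemma int_XD (μ : Measure ℝ) [IsProbabilityMeasure μ] (hsupp : μ (Icc (-2) 2)ᶜ = 0) (a v : ℕ → ℝ)
    (ho : Orth μ a) (h0 : v 0 = -1)
    (hav : ∀ k, (a (k+1))^2 = (1 - v k) * (1 + v (k+1))) (n : ℕ) :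
    ∫ x, (4 - x^2) / 2 * (Xp a v n).eval x ∂μ = Nn v n * (1 + v n * v (n+1)) := by
  have : (fun x => (4 - x^2) / 2 * (Xp a v n).eval x) = fun x =>
      ((Pm a (n+1) * Pm a (n+1)).eval x + (1 - v n)^2 * (Pm a n * Pm a n).eval x
      - (1 - v n) * (X * Pm a n * Pm a (n+1)).eval x) * (1/2) := by
    ext x
    have := X_D a v h0 hav x n
    simp only [eval_mul, eval_X]
    linear_combination (1/2) * this
  rw [this, integral_mul_const, integral_sub (Integrable.fun_add (int_poly μ hsupp _)
    ((int_poly μ hsupp _).const_mul _)) ((int_poly μ hsupp _).const_mul _),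
    integral_add (int_poly μ hsupp _) ((int_poly μ hsupp _).const_mul _),
    integral_const_mul, integral_const_mul, ho.2.2, ho.2.2, if_pos rfl, if_pos rfl,
    int_xPP μ hsupp a ho, Pi2_N' a v h0 hav]
  linear_combination (1/2) * (1 - v n) * Pi2_N a v h0 hav n

lemma match_poly (μ : Measure ℝ) [IsProbabilityMeasure μ] (hsupp : μ (Icc (-2) 2)ᶜ = 0)
    (a v : ℕ → ℝ) (ho : Orth μ a) (h0 : v 0 = -1) (hv : ∀ k, |v (k+1)| < 1)
    (hav : ∀ k, (a (k+1))^2 = (1 - v k) * (1 + v (k+1))) (hv1 : ∀ k, 0 < 1 - v k) (n : ℕ)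
    (Q : ℝ[X]) (hQ : Q.natDegree ≤ n) :
    Nn v n * Lam v n Q = ∫ x, Q.eval x ∂μ := by
  have ha : ∀ k, 0 < (a (k+1))^2 := fun k => pow_pos (ho.1 k) 2
  have hP : ∀ k ≤ n, Nn v n * Lam v n (Pm a k) = ∫ x, (Pm a k).eval x ∂μ := by
    intro k hk
    rw [Lam_P a v h0 hv hav hv1 ha n k hk]
    have := ho.2.2 k 0
    simp only [show Pm a 0 = 1 from rfl, mul_one] at this
    rw [this]
    split_ifs with h
    · simp [Pi2]
    · rfl
  have main : ∀ d ≤ n, ∀ Q : ℝ[X], Q.natDegree ≤ d → Nn v n * Lam v n Q = ∫ x, Q.eval x ∂μ := by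
    intro d
    induction d with
    | zero =>
      intro hd Q hQ
      have e := Polynomial.eq_C_of_natDegree_le_zero hQ
      have h1 := hP 0 hd
      rw [e, ← mul_one (C (Q.coeff 0)), Lam_C]
      rw [show Pm a 0 = 1 from rfl] at h1
      simp at h1 ⊢
      linear_combination (Q.coeff 0) * h1
    | succ d ih =>
      intro hd Q hQ
      set lc := (Pm a (d+1)).coeff (d+1) with hlc
      have hlc0 : lc ≠ 0 := by
        have h1 : (Pm a (d+1)).leadingCoeff ≠ 0 := by
          rw [Ne, leadingCoeff_eq_zero]
          intro h
          have := ho.2.1 (d+1)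
          rw [h] at this
          simp at this
        rw [leadingCoeff, ho.2.1] at h1
        exact h1
      set R := Q - C (Q.coeff (d+1) / lc) * Pm a (d+1) with hR
      have hRd : R.natDegree ≤ d := by
        rw [natDegree_le_iff_coeff_eq_zero]
        intro N hN
        rw [hR, coeff_sub, coeff_C_mul]
        rcases Nat.lt_or_ge (d+1) N with h | h
        · rw [coeff_eq_zero_of_natDegree_lt (p := Q) (by omega),
            coeff_eq_zero_of_natDegree_lt (p := Pm a (d+1)) (by rw [ho.2.1]; omega)]
          simp
        · obtain rfl : N = d+1 := by omega
          rw [← hlc]; field_simp; simp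
      have h1 := ih (by omega) R hRd
      have h2 := hP (d+1) hd
      rw [hR, Lam_sub v hv, Lam_C] at h1
      simp only [eval_sub, eval_mul, eval_C] at h1
      rw [integral_sub (int_poly μ hsupp _) ((int_poly μ hsupp _).const_mul _),
        integral_const_mul] at h1
      linear_combination h1 + (Q.coeff (d+1) / lc) * h2
  exact main n le_rfl Q hQ

lemma arc_meas : Measurable (fun x : ℝ => ENNReal.ofReal (1 / (π * Real.sqrt (4 - x^2)))) := by
  fun_prop

lemma img_cos : (fun θ : ℝ => 2 * Real.cos θ) '' Icc 0 π = Icc (-2) 2 := by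
  ext x
  constructor
  · rintro ⟨θ, _, rfl⟩
    have := Real.neg_one_le_cos θ
    have := Real.cos_le_one θ
    constructor <;> dsimp only <;> linarith
  · rintro ⟨h1, h2⟩
    obtain ⟨θ, h, e⟩ := Real.bijOn_cos.surjOn (show x / 2 ∈ Icc (-1:ℝ) 1 by
      constructor <;> linarith)
    exact ⟨θ, h, by dsimp only; rw [e]; ring⟩

lemma arc_map : ArcsineM = (ENNReal.ofReal (1/π) • volume.restrict (Ioo 0 π)).map
    (fun θ : ℝ => 2 * Real.cos θ) := by
  apply Measure.ext_of_lintegral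
  intro f hf
  have hm : Measurable (fun θ : ℝ => 2 * Real.cos θ) := by fun_prop
  rw [lintegral_map hf hm, lintegral_smul_measure, ArcsineM,
    lintegral_withDensity_eq_lintegral_mul _ arc_meas hf]
  set G : ℝ → ℝ≥0∞ := (fun x : ℝ => ENNReal.ofReal (1 / (π * Real.sqrt (4 - x^2)))) * f with hG
  have h1 : ∫⁻ x, G x = ∫⁻ x in Icc (-2) 2, G x := by
    symm
    apply setLIntegral_eq_of_support_subset
    intro x hx
    by_contra hn
    apply hx
    have : 4 - x^2 ≤ 0 := by
      by_contra h
      push Not at h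
      exact hn (abs_le.1 (abs_le_of_sq_le_sq (by nlinarith) (by norm_num)))
    simp [hG, Real.sqrt_eq_zero_of_nonpos this]
  rw [h1, ← img_cos, lintegral_image_eq_lintegral_abs_deriv_mul (f' := fun θ => -(2 * Real.sin θ))
    measurableSet_Icc]
  · rw [← Measure.restrict_congr_set Ioo_ae_eq_Icc, smul_eq_mul,
      ← lintegral_const_mul _ (show Measurable (fun θ => f (2 * Real.cos θ)) from hf.comp hm)]
    apply setLIntegral_congr_fun measurableSet_Ioo
    intro θ hθ
    have hs := Real.sin_pos_of_mem_Ioo hθ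
    have e : Real.sqrt (4 - (2 * Real.cos θ)^2) = 2 * Real.sin θ := by
      rw [show 4 - (2 * Real.cos θ)^2 = (2 * Real.sin θ)^2 by
        have := Real.sin_sq_add_cos_sq θ; linear_combination -4 * this]
      exact Real.sqrt_sq (by linarith)
    simp only [hG, Pi.mul_apply, e]
    rw [← mul_assoc, ← ENNReal.ofReal_mul (abs_nonneg _), abs_neg, abs_of_pos (by linarith)]
    congr 2
    field_simp
  · intro θ _
    have := ((Real.hasDerivAt_cos θ).const_mul 2).hasDerivWithinAt (s := Icc 0 π)
    exact this.congr_deriv (by ring)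
  · intro x hx y hy h
    exact Real.injOn_cos hx hy (by dsimp only at h; linarith)

instance arc_prob : IsProbabilityMeasure ArcsineM := by
  rw [arc_map]
  constructor
  rw [Measure.map_apply (by fun_prop) MeasurableSet.univ]
  simp only [preimage_univ, Measure.smul_apply, smul_eq_mul]
  simp [Real.volume_Ioo]
  rw [← ENNReal.ofReal_mul (by positivity)]
  rw [inv_mul_cancel₀ Real.pi_ne_zero]; simp

lemma arc_supp : ArcsineM (Icc (-2) 2)ᶜ = 0 := by
  rw [arc_map, Measure.map_apply (by fun_prop) measurableSet_Icc.compl]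
  rw [show (fun θ : ℝ => 2 * Real.cos θ) ⁻¹' (Icc (-2) 2)ᶜ = ∅ from ?_, measure_empty]
  ext θ
  simp only [mem_preimage, mem_compl_iff, mem_empty_iff_false, iff_false, not_not]
  have := Real.neg_one_le_cos θ
  have := Real.cos_le_one θ
  constructor <;> linarith

lemma arc_restrict : ArcsineM.restrict (Icc (-2) 2) = ArcsineM :=
  Measure.restrict_eq_self_of_ae_mem (by rw [ae_iff]; exact arc_supp)

lemma arc_integrable (f : ℝ → ℝ) (hf : ContinuousOn f (Icc (-2) 2)) : Integrable f ArcsineM := by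
  have := hf.integrableOn_compact (μ := ArcsineM) isCompact_Icc
  rwa [IntegrableOn, arc_restrict] at this

lemma arc_int (f : ℝ → ℝ) (hf : ContinuousOn f (Icc (-2) 2)) :
    ∫ x, f x ∂ArcsineM = circleAverage (fun z => f (2 * z.re)) 0 1 := by
  have hi := arc_integrable f hf
  have hm : Measurable (fun θ : ℝ => 2 * Real.cos θ) := by fun_prop
  have hmem : ∀ θ : ℝ, 2 * Real.cos θ ∈ Icc (-2:ℝ) 2 := by
    intro θ
    have := Real.neg_one_le_cos θ
    have := Real.cos_le_one θ
    constructor <;> linarith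
  have hc : Continuous (fun θ : ℝ => f (2 * Real.cos θ)) :=
    hf.comp_continuous (by fun_prop) hmem
  have h1 : ∫ x, f x ∂ArcsineM = (1/π) * ∫ θ in (0)..π, f (2 * Real.cos θ) := by
    have h2 := hi.aestronglyMeasurable
    rw [arc_map] at h2 ⊢
    rw [integral_map hm.aemeasurable h2, integral_smul_measure, ENNReal.toReal_ofReal (by positivity),
      intervalIntegral.integral_of_le Real.pi_pos.le, smul_eq_mul]
    congr 1
    exact setIntegral_congr_set Ioo_ae_eq_Ioc
  have h3 : ∀ θ, (circleMap 0 1 θ).re = Real.cos θ := by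
    intro θ; simp [circleMap, Complex.exp_ofReal_mul_I_re]
  have h4 : ∫ θ in π..(2*π), f (2 * Real.cos θ) = ∫ θ in (0)..π, f (2 * Real.cos θ) := by
    have := intervalIntegral.integral_comp_sub_left (a := 0) (b := π)
      (fun θ => f (2 * Real.cos θ)) (2 * π)
    rw [show 2 * π - π = π by ring, sub_zero] at this
    rw [← this]
    congr 1; ext θ
    rw [Real.cos_two_pi_sub]
  rw [h1, circleAverage_def]
  simp only [h3, smul_eq_mul]
  rw [← intervalIntegral.integral_add_adjacent_intervals (hc.intervalIntegrable 0 π)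
    (hc.intervalIntegrable π (2*π)), h4]
  field_simp
  ring

def Wt (γ x : ℝ) : ℝ := γ * (4 - x^2) / 2 + 1 - γ

lemma Wt_cont (γ : ℝ) : Continuous (Wt γ) := by unfold Wt; fun_prop

lemma Wt_circle (γ : ℝ) (z : ℂ) (hz : ‖z‖ = 1) : Wt γ (2 * z.re) = 1 - γ * (z^2).re := by
  have h : z.re^2 + z.im^2 = 1 := by
    have := Complex.normSq_eq_norm_sq z
    rw [hz, Complex.normSq_apply] at this
    linear_combination this
  simp only [Wt, pow_two, Complex.mul_re]
  linear_combination -γ * h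

lemma Wt_nonneg (γ x : ℝ) (h0 : 0 ≤ γ) (h1 : γ ≤ 1) (hx : x ∈ Icc (-2:ℝ) 2) : 0 ≤ Wt γ x := by
  unfold Wt
  have : 0 ≤ 4 - x^2 := by nlinarith [hx.1, hx.2]
  have := mul_nonneg h0 this
  linarith

lemma rhog_eq (g : ℝ) (hg : |g| ≤ 1) :
    rhog g = ArcsineM.withDensity (fun x => ENNReal.ofReal (Wt |g| x)) := by
  have hW : Measurable (fun x => ENNReal.ofReal (Wt |g| x)) :=
    (Wt_cont _).measurable.ennreal_ofReal
  have hS : Measurable (fun x : ℝ => ENNReal.ofReal (Real.sqrt (4 - x^2) / (2*π))) := by fun_prop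
  unfold rhog SCm
  rw [ArcsineM, ← withDensity_mul _ arc_meas hW, ← withDensity_smul _ hS,
    ← withDensity_smul _ arc_meas, ← withDensity_add_left (hS.const_smul _)]
  congr 1
  ext x
  simp only [Pi.add_apply, Pi.smul_apply, smul_eq_mul, Pi.mul_apply]
  rw [← ENNReal.ofReal_mul (abs_nonneg _), ← ENNReal.ofReal_mul (by linarith),
    ← ENNReal.ofReal_mul (by positivity), ← ENNReal.ofReal_add (by positivity)
      (mul_nonneg (by linarith) (by positivity))]
  congr 1
  rcases le_or_gt (4 - x^2) 0 with h | h
  · simp [Real.sqrt_eq_zero_of_nonpos h]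
  · have hs := Real.sqrt_pos.2 h
    have := Real.sq_sqrt h.le
    generalize Real.sqrt (4 - x^2) = s at *
    unfold Wt
    rw [← this]
    field_simp
    ring


lemma rho_supp (g : ℝ) (hg : |g| ≤ 1) : rhog g (Icc (-2) 2)ᶜ = 0 := by
  rw [rhog_eq g hg]
  exact withDensity_absolutelyContinuous _ _ arc_supp

lemma rho_ae_mem (g : ℝ) (hg : |g| ≤ 1) : ∀ᵐ x ∂(rhog g), x ∈ Icc (-2:ℝ) 2 := by
  rw [ae_iff]; exact rho_supp g hg

lemma rho_ae_W (g : ℝ) (hg : |g| ≤ 1) : ∀ᵐ x ∂(rhog g), 0 < Wt |g| x := by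
  rw [rhog_eq g hg, ae_withDensity_iff (Wt_cont _).measurable.ennreal_ofReal]
  filter_upwards with x hx
  simpa using hx

lemma rho_int' (g : ℝ) (hg : |g| ≤ 1) (f : ℝ → ℝ) : ∫ x, f x ∂(rhog g) = ∫ x, Wt |g| x * f x ∂ArcsineM := by
  rw [rhog_eq g hg, integral_withDensity_eq_integral_toReal_smul
    (Wt_cont _).measurable.ennreal_ofReal (by simp)]
  apply integral_congr_ae
  have : ∀ᵐ x ∂ArcsineM, x ∈ Icc (-2:ℝ) 2 := by rw [ae_iff]; exact arc_supp
  filter_upwards [this] with x hx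
  rw [ENNReal.toReal_ofReal (Wt_nonneg _ _ (abs_nonneg _) hg hx), smul_eq_mul]

lemma rho_integrable (g : ℝ) (hg : |g| ≤ 1) (f : ℝ → ℝ) (hf : ContinuousOn (fun x => Wt |g| x * f x) (Icc (-2) 2)) :
    Integrable f (rhog g) := by
  rw [rhog_eq g hg, integrable_withDensity_iff_integrable_smul'
    (Wt_cont _).measurable.ennreal_ofReal (by simp)]
  apply (arc_integrable _ hf).congr
  have : ∀ᵐ x ∂ArcsineM, x ∈ Icc (-2:ℝ) 2 := by rw [ae_iff]; exact arc_supp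
  filter_upwards [this] with x hx
  rw [ENNReal.toReal_ofReal (Wt_nonneg _ _ (abs_nonneg _) hg hx), smul_eq_mul]

lemma rho_int (g : ℝ) (hg : |g| ≤ 1) (f : ℝ → ℝ) (hf : ContinuousOn (fun x => Wt |g| x * f x) (Icc (-2) 2)) :
    ∫ x, f x ∂(rhog g) = circleAverage (fun z => f (2 * z.re) * (1 - |g| * (z^2).re)) 0 1 := by
  rw [rho_int' g hg, arc_int _ hf]
  apply circleAverage_congr_sphere
  intro z hz
  dsimp only
  rw [Wt_circle _ z (by simpa using hz), mul_comm]

lemma rho_fin (g : ℝ) (hg : |g| ≤ 1) : IsFiniteMeasure (rhog g) := by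
  rw [rhog_eq g hg]
  exact isFiniteMeasure_withDensity_ofReal
    (arc_integrable _ (Wt_cont _).continuousOn).hasFiniteIntegral

lemma ca_W (γ : ℝ) : circleAverage (fun z => (1 - γ * (z^2).re)) 0 1 = 1 := by
  have := ca_re (fun z => 1 - γ * z^2) (by intro z _; fun_prop)
  simpa [Complex.mul_re] using this

lemma rho_prob (g : ℝ) (hg : |g| ≤ 1) : IsProbabilityMeasure (rhog g) := by
  have := rho_fin g hg
  have h := rho_int g hg (fun _ => 1) (by simpa using (Wt_cont _).continuousOn)
  simp only [one_mul, ca_W] at h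
  simp [Measure.real] at h
  constructor
  rw [← ENNReal.toReal_eq_one_iff]; exact h


def Jf (γ : ℝ) : ℝ := Real.log ((1 + Real.sqrt (1 - γ^2)) / 2) + 1 - Real.sqrt (1 - γ^2)

lemma J_lt (γ : ℝ) (h0 : 0 ≤ γ) (h1 : γ < 1) :
    circleAverage (fun z => (1 - γ * (z^2).re) * Real.log (1 - γ * (z^2).re)) 0 1 = Jf γ := by
  set s := Real.sqrt (1 - γ^2) with hs
  have hs0 : 0 ≤ s := Real.sqrt_nonneg _
  have hs2 : s^2 = 1 - γ^2 := Real.sq_sqrt (by nlinarith)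
  set r := γ / (1 + s) with hr
  have hrγ : r * (1 + s) = γ := by rw [hr]; field_simp
  have hr0 : 0 ≤ r := by positivity
  have hr1 : r < 1 := by rw [hr, div_lt_one (by positivity)]; linarith
  have hd : Differentiable ℂ (fun w : ℂ => 1 - (r:ℂ) * w) := by fun_prop
  have hne : ∀ w : ℂ, ‖w‖ ≤ 1 → (1 - (r:ℂ) * w) ≠ 0 := by
    intro w hw h
    have : (r:ℂ) * w = 1 := by linear_combination -h
    have h2 : ‖(r:ℂ) * w‖ = 1 := by rw [this]; simp
    rw [norm_mul, Complex.norm_real, Real.norm_of_nonneg hr0] at h2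
    nlinarith [norm_nonneg w]
  have hder : HasDerivAt (fun w : ℂ => 1 - (r:ℂ) * w) (-(r:ℂ)) 0 := by
    simpa using ((hasDerivAt_id (0:ℂ)).const_mul (r:ℂ)).const_sub 1
  have key := meanlog _ hd hne (by simp) _ hder γ
  have hc2 : ContinuousOn (fun z : ℂ => 1 - γ * (z^2).re) (Metric.sphere 0 1) := by fun_prop
  have hc1 : ContinuousOn (fun z : ℂ => Real.log (‖1 - (r:ℂ) * z^2‖^2) * (1 - γ * (z^2).re))
      (Metric.sphere 0 1) := by
    apply ContinuousOn.mul _ hc2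
    apply ContinuousOn.log (by fun_prop)
    intro z hz
    have : ‖z‖ = 1 := by simpa using hz
    have := hne (z^2) (by simp [this])
    positivity
  have e : circleAverage (fun z => (1 - γ * (z^2).re) * Real.log (1 - γ * (z^2).re)) 0 1
      = circleAverage (fun z => Real.log (‖1 - (r:ℂ) * z^2‖^2) * (1 - γ * (z^2).re)
        + Real.log ((1+s)/2) • (1 - γ * (z^2).re)) 0 1 := by
    apply circleAverage_congr_sphere
    intro z hz
    have hz1 : ‖z‖ = 1 := by simpa using hz
    dsimp only
    have hn := hne (z^2) (by simp [hz1])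
    have h2 : 1 - γ * (z^2).re = (1+s)/2 * ‖1 - (r:ℂ) * z^2‖^2 := by
      rw [← Complex.normSq_eq_norm_sq, Complex.normSq_apply]
      have h3 : (z^2).re^2 + (z^2).im^2 = 1 := by
        have := Complex.normSq_eq_norm_sq (z^2)
        rw [norm_pow, hz1, Complex.normSq_apply] at this
        linear_combination this
      generalize z^2 = w at h3 ⊢
      simp [Complex.mul_re, Complex.mul_im]
      have h4 : (1+s) * r^2 = 1 - s := by
        have : (1+s) * ((1+s) * r^2) = (1+s) * (1 - s) := by
          linear_combination (r * (1+s) + γ) * hrγ + hs2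
        exact mul_left_cancel₀ (by positivity) this
      linear_combination (- w.re) * hrγ * (-1) - (1+s)/2 * r^2 * h3 - h4/2
    have h5 : Real.log (1 - γ * (z^2).re)
        = Real.log ((1+s)/2) + Real.log (‖1 - (r:ℂ) * z^2‖^2) := by
      rw [h2, Real.log_mul (by positivity) (by positivity)]
    rw [h5, smul_eq_mul]; ring
  have hc3 : ContinuousOn (fun z : ℂ => Real.log ((1+s)/2) • (1 - γ * (z^2).re))
      (Metric.sphere 0 1) := by fun_prop
  rw [e, circleAverage_fun_add (ci_cont _ hc1) (ci_cont _ hc3), key, circleAverage_fun_smul, ca_W,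
    Jf, ← hs]
  simp
  have : γ * r = 1 - s := by
    have : (1+s) * (γ * r) = (1+s) * (1 - s) := by linear_combination γ * hrγ + hs2
    exact mul_left_cancel₀ (by positivity) this
  linear_combination this

lemma J_all (γ : ℝ) (h0 : 0 ≤ γ) (h1 : γ ≤ 1) :
    circleAverage (fun z => (1 - γ * (z^2).re) * Real.log (1 - γ * (z^2).re)) 0 1 = Jf γ := by
  have hE : EqOn (fun γ : ℝ => circleAverage (fun z => (1 - γ * (z^2).re)
      * Real.log (1 - γ * (z^2).re)) 0 1) Jf (Ico 0 1) := fun γ h => J_lt γ h.1 h.2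
  have := hE.closure (by
    simp only [circleAverage_def]
    apply Continuous.fun_const_smul
    apply intervalIntegral.continuous_parametric_intervalIntegral_of_continuous'
    have hc : Continuous (fun p : ℝ × ℝ => 1 - p.1 * ((circleMap 0 1 p.2)^2).re) := by
      have : Continuous (fun p : ℝ × ℝ => circleMap 0 1 p.2) :=
        (continuous_circleMap 0 1).comp continuous_snd
      fun_prop
    exact Real.continuous_mul_log.comp hc) (by
    unfold Jf
    apply Continuous.sub _ (by fun_prop)
    apply Continuous.add _ (by fun_prop)
    apply Continuous.log (by fun_prop)
    intro x; positivity)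
  rw [closure_Ico (by norm_num)] at this
  exact this ⟨h0, h1⟩

def TT (v : ℕ → ℝ) (γ : ℝ) (n : ℕ) : ℝ :=
  -γ * (∑ k ∈ Finset.range n, v (k+1) * v k) - Real.log (Nn v n) + Jf γ

lemma Nn_pos (v : ℕ → ℝ) (hv : ∀ k, |v (k+1)| < 1) (n : ℕ) : 0 < Nn v n := by
  apply Finset.prod_pos
  intro k _
  have := sq_lt_one_iff_abs_lt_one (v (k+1)) |>.2 (hv k)
  linarith

lemma exists_circ (x : ℝ) (hx : x ∈ Icc (-2:ℝ) 2) : ∃ z : ℂ, ‖z‖ = 1 ∧ 2 * z.re = x := by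
  rw [← img_cos] at hx
  obtain ⟨θ, _, rfl⟩ := hx
  refine ⟨Complex.exp (θ * Complex.I), Complex.norm_exp_ofReal_mul_I θ, ?_⟩
  rw [Complex.exp_ofReal_mul_I_re]

lemma X_pos (a v : ℕ → ℝ) (h0 : v 0 = -1) (hv : ∀ k, |v (k+1)| < 1)
    (hav : ∀ k, (a (k+1))^2 = (1 - v k) * (1 + v (k+1))) (n : ℕ) (x : ℝ)
    (hx : x ∈ Icc (-2:ℝ) 2) : 0 < (Xp a v n).eval x := by
  obtain ⟨z, hz, rfl⟩ := exists_circ x hx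
  rw [X_circle a v h0 hav z hz n]
  have := fB_ne v hv n z hz.le
  positivity

/-- log of the n-th approximating density. -/
def ell (a v : ℕ → ℝ) (γ : ℝ) (n : ℕ) (x : ℝ) : ℝ :=
  Real.log ((Xp a v n).eval x) - Real.log (Nn v n) + Real.log (Wt γ x)

lemma ell_cont (a v : ℕ → ℝ) (γ : ℝ) (h0 : v 0 = -1) (hv : ∀ k, |v (k+1)| < 1)
    (hav : ∀ k, (a (k+1))^2 = (1 - v k) * (1 + v (k+1))) (n : ℕ) :
    ContinuousOn (fun x => Wt γ x * ell a v γ n x) (Icc (-2) 2) := by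
  have hX : ContinuousOn (fun x => Real.log ((Xp a v n).eval x)) (Icc (-2) 2) :=
    ContinuousOn.log (Xp a v n).continuous.continuousOn
      (fun x hx => (X_pos a v h0 hv hav n x hx).ne')
  have h1 : ContinuousOn (fun x => Wt γ x * (Real.log ((Xp a v n).eval x) - Real.log (Nn v n))
      + Wt γ x * Real.log (Wt γ x)) (Icc (-2) 2) := by
    apply ContinuousOn.add
    · exact (Wt_cont γ).continuousOn.mul (hX.sub continuousOn_const)
    · exact (Real.continuous_mul_log.comp (Wt_cont γ)).continuousOn
  refine h1.congr ?_
  intro x _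
  simp only [ell]; ring

lemma ell_int (g : ℝ) (hg : |g| ≤ 1) (a v : ℕ → ℝ) (h0 : v 0 = -1) (hv : ∀ k, |v (k+1)| < 1)
    (hav : ∀ k, (a (k+1))^2 = (1 - v k) * (1 + v (k+1))) (n : ℕ) :
    Integrable (ell a v |g| n) (rhog g) ∧ ∫ x, ell a v |g| n x ∂(rhog g) = TT v |g| n := by
  have hc := ell_cont a v |g| h0 hv hav n
  refine ⟨rho_integrable g hg _ hc, ?_⟩
  rw [rho_int g hg _ hc]
  set γ := |g| with hγ
  have hd := (fAB_diff v n).2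
  have hB := hd.continuous
  have key := meanlog (fB v n) hd (fun w hw => (fAB_disc v hv w hw n).2)
    (fA_at_zero v h0 n).2 _ (fB_deriv v h0 n) γ
  have hJ := J_all γ (abs_nonneg _) hg
  have hc1 : ContinuousOn (fun z : ℂ => Real.log (‖fB v n (z^2)‖^2) * (1 - γ * (z^2).re))
      (Metric.sphere 0 1) := by
    apply ContinuousOn.mul _ (by fun_prop)
    apply ContinuousOn.log (by fun_prop)
    intro z hz
    have : ‖z‖ = 1 := by simpa using hz
    have := fB_ne v hv n z this.le
    positivity
  have hc2 : ContinuousOn (fun z : ℂ => (1 - γ * (z^2).re) * Real.log (1 - γ * (z^2).re))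
      (Metric.sphere 0 1) := by
    apply Continuous.continuousOn
    exact Real.continuous_mul_log.comp (by fun_prop : Continuous fun z : ℂ => 1 - γ * (z^2).re)
  have hc3 : ContinuousOn (fun z : ℂ => (-Real.log (Nn v n)) • (1 - γ * (z^2).re))
      (Metric.sphere 0 1) := by fun_prop
  have e : circleAverage (fun z => ell a v γ n (2 * z.re) * (1 - γ * (z^2).re)) 0 1
      = circleAverage (fun z => (Real.log (‖fB v n (z^2)‖^2) * (1 - γ * (z^2).re)
        + (1 - γ * (z^2).re) * Real.log (1 - γ * (z^2).re))
        + (-Real.log (Nn v n)) • (1 - γ * (z^2).re)) 0 1 := by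
    apply circleAverage_congr_sphere
    intro z hz
    have hz1 : ‖z‖ = 1 := by simpa using hz
    simp only [ell, Wt_circle γ z hz1, X_circle a v h0 hav z hz1 n, smul_eq_mul]
    ring
  rw [e, circleAverage_fun_add (ci_cont _ (hc1.fun_add hc2)) (ci_cont _ hc3),
    circleAverage_fun_add (ci_cont _ hc1) (ci_cont _ hc2), key, hJ, circleAverage_fun_smul, ca_W,
    TT, Complex.ofReal_re]
  simp only [smul_eq_mul]; ring

lemma ifsub {ν : Measure ℝ} {f g : ℝ → ℝ} (hf : Integrable f ν) (hg : Integrable g ν) :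
    Integrable (fun x => f x - g x) ν := hf.sub hg

lemma log_ineq (y t c : ℝ) (hc : 0 < c) (ht : Real.exp y = t) : y ≤ t / c - 1 + Real.log c := by
  have ht' : 0 < t := ht ▸ Real.exp_pos y
  have h1 : y = Real.log t := by rw [← ht, Real.log_exp]
  have h2 := Real.log_le_sub_one_of_pos (div_pos ht' hc)
  rw [Real.log_div ht'.ne' hc.ne'] at h2
  linarith

lemma DV (ρ μ : Measure ℝ) [IsProbabilityMeasure ρ] [IsProbabilityMeasure μ] (hac : ρ ≪ μ)
    (hll : Integrable (llr ρ μ) ρ) (l H : ℝ → ℝ) (hl : Integrable l ρ) (hH : Integrable H μ)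
    (hlH : ∀ᵐ x ∂ρ, Real.exp (l x) = H x) (hH0 : ∀ᵐ x ∂μ, 0 ≤ H x) (hc : 0 < ∫ x, H x ∂μ) :
    ∫ x, l x ∂ρ - Real.log (∫ x, H x ∂μ) ≤ ∫ x, llr ρ μ x ∂ρ := by
  set c := ∫ x, H x ∂μ with hcdef
  set f : ℝ → ℝ := fun x => (ρ.rnDeriv μ x).toReal with hf
  have hfm : Measurable f := (Measure.measurable_rnDeriv ρ μ).ennreal_toReal
  have hle : ∀ x, 0 ≤ H x → f x • (H x / f x) ≤ H x := by
    intro x hx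
    rw [smul_eq_mul]
    rcases eq_or_ne (f x) 0 with h | h
    · rw [h, zero_mul]; exact hx
    · rw [mul_div_cancel₀ _ h]
  have hi1 : Integrable (fun x => f x • (H x / f x)) μ := by
    apply hH.mono
    · exact hfm.aestronglyMeasurable.smul (hH.aestronglyMeasurable.div₀ hfm.aestronglyMeasurable)
    · filter_upwards [hH0] with x hx
      have h0 : 0 ≤ f x := ENNReal.toReal_nonneg
      rw [Real.norm_of_nonneg hx, Real.norm_of_nonneg (smul_nonneg h0 (div_nonneg hx h0))]
      exact hle x hx
  have hi2 : Integrable (fun x => H x / f x) ρ := (integrable_rnDeriv_smul_iff hac).1 hi1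
  have hI : ∫ x, H x / f x ∂ρ ≤ c := by
    rw [← integral_rnDeriv_smul hac]
    apply integral_mono_ae hi1 hH
    filter_upwards [hH0] with x hx
    exact hle x hx
  have hpos : ∀ᵐ x ∂ρ, 0 < f x := by
    filter_upwards [Measure.rnDeriv_pos hac, hac.ae_le (Measure.rnDeriv_lt_top ρ μ)] with x h1 h2
    exact ENNReal.toReal_pos h1.ne' h2.ne
  have hfin : ∫ x, (l x - llr ρ μ x) ∂ρ ≤ ∫ x, (H x / f x / c - 1 + Real.log c) ∂ρ := by
    apply integral_mono_ae (ifsub hl hll)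
    · exact Integrable.fun_add (ifsub (hi2.div_const c) (integrable_const _)) (integrable_const _)
    · filter_upwards [hpos, hlH] with x h1 h2
      apply log_ineq _ _ _ hc
      rw [Real.exp_sub, h2, llr, Real.exp_log h1]
  rw [integral_sub hl hll, integral_add (ifsub (hi2.div_const c) (integrable_const _))
    (integrable_const _), integral_sub (hi2.div_const c) (integrable_const _), integral_div] at hfin
  simp at hfin
  have : (∫ x, H x / f x ∂ρ) / c ≤ 1 := (div_le_one hc).2 hI
  linarith

lemma lsc_meas (ρ μ : Measure ℝ) [IsProbabilityMeasure ρ] [IsProbabilityMeasure μ] (L : ℝ)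
    (hφ : ∀ φ : ℝ → ℝ, Continuous φ → (∃ M, ∀ x, |φ x| ≤ M) →
      ∫ x, φ x ∂ρ ≤ L + Real.log (∫ x, Real.exp (φ x) ∂μ))
    (φ : ℝ → ℝ) (hm : Measurable φ) (M : ℝ) (hM : ∀ x, |φ x| ≤ M) :
    ∫ x, φ x ∂ρ ≤ L + Real.log (∫ x, Real.exp (φ x) ∂μ) := by
  have hM0 : 0 ≤ M := (abs_nonneg _).trans (hM 0)
  have hbi : ∀ (ν : Measure ℝ) [IsFiniteMeasure ν] (f : ℝ → ℝ), Measurable f →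
      (∃ K, ∀ x, |f x| ≤ K) → Integrable f ν := by
    intro ν _ f hf ⟨K, hK⟩
    exact Integrable.of_bound hf.aestronglyMeasurable K (Eventually.of_forall hK)
  have hexpb : ∀ f : ℝ → ℝ, (∀ x, |f x| ≤ M) → ∃ K, ∀ x, |Real.exp (f x)| ≤ K := by
    intro f hf
    refine ⟨Real.exp M, fun x => ?_⟩
    rw [abs_of_pos (Real.exp_pos _)]
    exact Real.exp_le_exp.2 ((le_abs_self _).trans (hf x))
  set I := ∫ x, Real.exp (φ x) ∂μ with hI
  have hEi : Integrable (fun x => Real.exp (φ x)) μ := hbi μ _ hm.exp (hexpb φ hM)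
  have hIpos : 0 < I := integral_exp_pos hEi
  have main : ∀ ε > 0, ∫ x, φ x ∂ρ ≤ ε + (L + Real.log (I + Real.exp M * ε)) := by
    intro ε hε
    obtain ⟨g, hg, hgi⟩ := (hbi (ρ + μ) φ hm ⟨M, hM⟩).exists_boundedContinuous_integral_sub_le hε
    set ψ : ℝ → ℝ := fun x => max (-M) (min (g x) M) with hψ
    have hψc : Continuous ψ := by
      have := g.continuous
      fun_prop
    have hψM : ∀ x, |ψ x| ≤ M := by
      intro x
      rw [abs_le]
      exact ⟨le_max_left _ _, max_le (by linarith) (min_le_right _ _)⟩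
    have hcl : ∀ x, |φ x - ψ x| ≤ |φ x - g x| := by
      intro x
      obtain ⟨h1, h2⟩ := abs_le.1 (hM x)
      have e : φ x = max (-M) (min (φ x) M) := by
        rw [min_eq_left h2, max_eq_right h1]
      calc |φ x - ψ x| = |max (-M) (min (φ x) M) - max (-M) (min (g x) M)| := by rw [← e]
        _ ≤ |min (φ x) M - min (g x) M| := by
          have := abs_max_sub_max_le_max (-M) (min (φ x) M) (-M) (min (g x) M)
          simpa using this
        _ ≤ |φ x - g x| := by
          have := abs_min_sub_min_le_max (φ x) M (g x) M
          simpa using this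
    set d : ℝ → ℝ := fun x => |φ x - ψ x| with hd
    have hdm : Measurable d := (hm.sub hψc.measurable).abs
    have hdb : ∃ K, ∀ x, |d x| ≤ K := by
      refine ⟨M + M, fun x => ?_⟩
      simp only [hd, abs_abs]
      exact (abs_sub _ _).trans (add_le_add (hM x) (hψM x))
    have hdi1 := hbi ρ d hdm hdb
    have hdi2 := hbi μ d hdm hdb
    have hdtot : ∫ x, d x ∂ρ + ∫ x, d x ∂μ ≤ ε := by
      rw [← integral_add_measure hdi1 hdi2]
      refine le_trans (integral_mono (hbi (ρ + μ) d hdm hdb) ?_ hcl) hg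
      exact ((hbi (ρ + μ) φ hm ⟨M, hM⟩).sub hgi).norm
    have hd1 : 0 ≤ ∫ x, d x ∂ρ := integral_nonneg (fun x => abs_nonneg _)
    have hd2 : 0 ≤ ∫ x, d x ∂μ := integral_nonneg (fun x => abs_nonneg _)
    have h1 := hφ ψ hψc ⟨M, hψM⟩
    have hψi := hbi ρ ψ hψc.measurable ⟨M, hψM⟩
    have h2 : ∫ x, φ x ∂ρ ≤ ∫ x, ψ x ∂ρ + ∫ x, d x ∂ρ := by
      rw [← integral_add hψi hdi1]
      apply integral_mono (hbi ρ φ hm ⟨M, hM⟩) (hψi.add hdi1)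
      intro x
      have := le_abs_self (φ x - ψ x)
      simp only [hd, Pi.add_apply]; linarith
    have hψe := hbi μ _ hψc.measurable.exp (hexpb ψ hψM)
    have h3 : ∫ x, Real.exp (ψ x) ∂μ ≤ I + Real.exp M * ∫ x, d x ∂μ := by
      rw [← integral_const_mul, hI, ← integral_add hEi (hdi2.const_mul _)]
      apply integral_mono hψe (hEi.add (hdi2.const_mul _))
      intro x
      simp only [hd, Pi.add_apply]
      have e1 : Real.exp (φ x) = Real.exp (ψ x) * Real.exp (φ x - ψ x) := by
        rw [← Real.exp_add]; ring_nf
      have e2 := Real.add_one_le_exp (φ x - ψ x)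
      have e3 : Real.exp (ψ x) ≤ Real.exp M :=
        Real.exp_le_exp.2 ((le_abs_self _).trans (hψM x))
      have e4 := neg_abs_le (φ x - ψ x)
      have e5 := mul_le_mul_of_nonneg_left e2 (Real.exp_pos (ψ x)).le
      have e6 := mul_le_mul_of_nonneg_left e4 (Real.exp_pos (ψ x)).le
      have e7 := mul_le_mul_of_nonneg_right e3 (abs_nonneg (φ x - ψ x))
      rw [e1]
      linarith
    have h4 : Real.log (∫ x, Real.exp (ψ x) ∂μ) ≤ Real.log (I + Real.exp M * ε) := by
      apply Real.log_le_log (integral_exp_pos hψe)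
      refine h3.trans ?_
      gcongr
      linarith
    linarith
  have hlim : Tendsto (fun ε : ℝ => ε + (L + Real.log (I + Real.exp M * ε))) (𝓝[>] 0)
      (𝓝 (0 + (L + Real.log (I + Real.exp M * 0)))) := by
    apply Tendsto.mono_left _ nhdsWithin_le_nhds
    apply Tendsto.add tendsto_id
    apply Tendsto.add tendsto_const_nhds
    apply Tendsto.log
    · exact tendsto_const_nhds.add (tendsto_id.const_mul _)
    · simpa using hIpos.ne'
  have := ge_of_tendsto hlim (b := ∫ x, φ x ∂ρ) (by
    filter_upwards [self_mem_nhdsWithin] with ε hε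
    exact main ε hε)
  simpa using this

lemma clamp_aux (N f : ℝ) (hN : 1 ≤ N) (hf : 0 < f) :
    |Real.log (max (1/N) (min f N))| ≤ |Real.log f| := by
  have hN1 : 1/N ≤ 1 := by rw [div_le_one (by linarith)]; exact hN
  have hN0 : 0 < 1/N := by positivity
  rcases le_total f 1 with h | h
  · have h1 : f ≤ max (1/N) (min f N) := by
      rw [min_eq_left (by linarith)]; exact le_max_right _ _
    have h2 : max (1/N) (min f N) ≤ 1 := max_le hN1 ((min_le_left _ _).trans h)
    rw [abs_of_nonpos (Real.log_nonpos (by linarith) h2), abs_of_nonpos (Real.log_nonpos hf.le h)]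
    have := Real.log_le_log hf h1
    linarith
  · have h1 : 1 ≤ max (1/N) (min f N) := le_max_of_le_right (le_min h hN)
    have h2 : max (1/N) (min f N) ≤ f := max_le (by linarith) (min_le_left _ _)
    rw [abs_of_nonneg (Real.log_nonneg h1), abs_of_nonneg (Real.log_nonneg h)]
    exact Real.log_le_log (by linarith) h2

lemma neg_aux (N f : ℝ) (hN : 1 ≤ N) (hf : 0 ≤ f) :
    f * max (-Real.log (max (1/N) (min f N))) 0 ≤ 1 := by
  have hN0 : 0 < 1/N := by positivity
  rcases hf.eq_or_lt with h | h
  · rw [← h, zero_mul]; norm_num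
  rcases le_total f 1 with h1 | h1
  · have h2 : f ≤ max (1/N) (min f N) := by
      rw [min_eq_left (by linarith)]; exact le_max_right _ _
    have h3 := Real.log_le_log h h2
    have h4 := Real.log_le_sub_one_of_pos (inv_pos.2 h)
    rw [Real.log_inv] at h4
    have h5 : max (-Real.log (max (1/N) (min f N))) 0 ≤ f⁻¹ :=
      max_le (by linarith) (by positivity)
    calc _ ≤ f * f⁻¹ := by gcongr
      _ = 1 := mul_inv_cancel₀ h.ne'
  · have h2 : 1 ≤ max (1/N) (min f N) := le_max_of_le_right (le_min h1 hN)
    have h3 := Real.log_nonneg h2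
    rw [max_eq_right (by linarith), mul_zero]; norm_num

lemma lsc (ρ μ : Measure ℝ) [IsProbabilityMeasure ρ] [IsProbabilityMeasure μ] (L : ℝ)
    (hφ : ∀ φ : ℝ → ℝ, Continuous φ → (∃ M, ∀ x, |φ x| ≤ M) →
      ∫ x, φ x ∂ρ ≤ L + Real.log (∫ x, Real.exp (φ x) ∂μ)) :
    ρ ≪ μ ∧ Integrable (llr ρ μ) ρ ∧ ∫ x, llr ρ μ x ∂ρ ≤ L := by
  have hφ' := lsc_meas ρ μ L hφ
  have hac : ρ ≪ μ := by
    apply Measure.AbsolutelyContinuous.mk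
    intro A hA hμA
    have h1 : ∀ M : ℝ, 0 ≤ M → M * ρ.real A ≤ L := by
      intro M hM
      have := hφ' (A.indicator (fun _ => M)) (measurable_const.indicator hA) M (by
        intro x
        by_cases hx : x ∈ A
        · simp [hx, abs_of_nonneg hM]
        · simp [hx, hM])
      rw [integral_indicator_const _ hA] at this
      have e : ∫ x, Real.exp (A.indicator (fun _ => M) x) ∂μ = ∫ x, (1:ℝ) ∂μ := by
        apply integral_congr_ae
        have : ∀ᵐ x ∂μ, x ∉ A := measure_eq_zero_iff_ae_notMem.1 hμA
        filter_upwards [this] with x hx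
        simp [hx]
      rw [e] at this
      simp at this
      linarith
    have h2 : ρ.real A = 0 := by
      by_contra hne
      have hpos : 0 < ρ.real A := lt_of_le_of_ne measureReal_nonneg (Ne.symm hne)
      have := h1 ((|L| + 1) / ρ.real A) (by positivity)
      rw [div_mul_cancel₀ _ hne] at this
      linarith [le_abs_self L]
    exact (measureReal_eq_zero_iff).1 h2
  set f : ℝ → ℝ := fun x => (ρ.rnDeriv μ x).toReal with hf
  have hfm : Measurable f := (Measure.measurable_rnDeriv ρ μ).ennreal_toReal
  have hf0 : ∀ x, 0 ≤ f x := fun x => ENNReal.toReal_nonneg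
  have hfi : Integrable f μ := Measure.integrable_toReal_rnDeriv
  have hfI : ∫ x, f x ∂μ = 1 := by
    rw [hf, Measure.integral_toReal_rnDeriv hac]; simp
  have hpos : ∀ᵐ x ∂ρ, 0 < f x := by
    filter_upwards [Measure.rnDeriv_pos hac, hac.ae_le (Measure.rnDeriv_lt_top ρ μ)] with x h1 h2
    exact ENNReal.toReal_pos h1.ne' h2.ne
  set N : ℕ → ℝ := fun m => (m:ℝ) + 1 with hN
  have hN1 : ∀ m, 1 ≤ N m := fun m => by simp [hN]
  set F : ℕ → ℝ → ℝ := fun m x => max (1 / N m) (min (f x) (N m)) with hF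
  have hFm : ∀ m, Measurable (F m) := fun m => measurable_const.max (hfm.min measurable_const)
  have hFlo : ∀ m x, 1 / N m ≤ F m x := fun m x => le_max_left _ _
  have hNpos : ∀ m, 0 < N m := fun m => by linarith [hN1 m]
  have hFpos : ∀ m x, 0 < F m x := fun m x => lt_of_lt_of_le (by have := hNpos m; positivity) (hFlo m x)
  have hFhi : ∀ m x, F m x ≤ N m := fun m x => max_le (by
    have := hN1 m
    rw [div_le_iff₀ (hNpos m)]; nlinarith) (min_le_right _ _)
  have hlb : ∀ m x, |Real.log (F m x)| ≤ Real.log (N m) := by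
    intro m x
    rw [abs_le]
    constructor
    · have := Real.log_le_log (by have := hNpos m; positivity) (hFlo m x)
      rw [one_div, Real.log_inv] at this
      exact this
    · exact Real.log_le_log (hFpos m x) (hFhi m x)
  have hstep : ∀ m, ∫ x, Real.log (F m x) ∂ρ ≤ L + Real.log (1 + 1 / N m) := by
    intro m
    refine (hφ' (fun x => Real.log (F m x)) (hFm m).log (Real.log (N m)) (hlb m)).trans ?_
    simp only [Real.exp_log (hFpos m _)]
    have hFi : Integrable (F m) μ := by
      refine Integrable.of_bound (hFm m).aestronglyMeasurable (N m) (Eventually.of_forall ?_)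
      intro x
      rw [Real.norm_of_nonneg (hFpos m x).le]; exact hFhi m x
    have h1 : ∫ x, F m x ∂μ ≤ 1 + 1 / N m := by
      calc ∫ x, F m x ∂μ ≤ ∫ x, (f x + 1 / N m) ∂μ := by
            apply integral_mono hFi (hfi.fun_add (integrable_const _))
            intro x
            have h2 : 0 < 1 / N m := by have := hNpos m; positivity
            exact max_le (by linarith [hf0 x]) ((min_le_left _ _).trans (by linarith))
        _ = 1 + 1 / N m := by
            rw [integral_add hfi (integrable_const _), hfI]; simp
    have h2 : 0 < ∫ x, F m x ∂μ := by
      have : ∫ x, (1 / N m) ∂μ ≤ ∫ x, F m x ∂μ :=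
        integral_mono (integrable_const _) hFi (hFlo m)
      have h3 : 0 < 1 / N m := by have := hNpos m; positivity
      rw [integral_const] at this
      simp only [probReal_univ, one_smul] at this
      linarith
    gcongr
  have hLi : ∀ m, Integrable (fun x => Real.log (F m x)) ρ := fun m =>
    Integrable.of_bound (hFm m).log.aestronglyMeasurable (Real.log (N m))
      (Eventually.of_forall (hlb m))
  have hneg : ∀ m, ∫ x, max (-Real.log (F m x)) 0 ∂ρ ≤ 1 := by
    intro m
    have hi : Integrable (fun x => max (-Real.log (F m x)) 0) ρ := (hLi m).neg.pos_part
    have hi' := (integrable_rnDeriv_smul_iff hac).2 hi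
    rw [← integral_rnDeriv_smul hac]
    calc _ ≤ ∫ x, (1:ℝ) ∂μ := by
          apply integral_mono hi' (integrable_const _)
          intro x
          exact neg_aux (N m) (f x) (hN1 m) (hf0 x)
      _ = 1 := by simp
  have habs : ∀ m, ∫ x, |Real.log (F m x)| ∂ρ ≤ L + Real.log 2 + 2 := by
    intro m
    have hi : Integrable (fun x => max (-Real.log (F m x)) 0) ρ := (hLi m).neg.pos_part
    have e : (fun x => |Real.log (F m x)|)
        = fun x => Real.log (F m x) + 2 * max (-Real.log (F m x)) 0 := by
      ext x
      rcases le_total (Real.log (F m x)) 0 with h | h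
      · rw [abs_of_nonpos h, max_eq_left (by linarith)]; ring
      · rw [abs_of_nonneg h, max_eq_right (by linarith)]; ring
    rw [e, integral_add (hLi m) (hi.const_mul _), integral_const_mul]
    have h1 := hstep m
    have h2 := hneg m
    have h3 : Real.log (1 + 1 / N m) ≤ Real.log 2 := by
      have h4 : 1 / N m ≤ 1 := by rw [div_le_one (hNpos m)]; exact hN1 m
      have h5 : 0 < 1 / N m := by have := hNpos m; positivity
      apply Real.log_le_log <;> linarith
    linarith
  have hconv : ∀ᵐ x ∂ρ, Tendsto (fun m => Real.log (F m x)) atTop (𝓝 (llr ρ μ x)) := by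
    filter_upwards [hpos] with x hx
    apply tendsto_const_nhds.congr'
    obtain ⟨m0, hm0⟩ := exists_nat_gt (max (f x) (1 / f x))
    filter_upwards [eventually_ge_atTop m0] with m hm
    have hm' : max (f x) (1 / f x) ≤ N m := by
      have : (m0:ℝ) ≤ m := by exact_mod_cast hm
      simp only [hN]; linarith
    have h1 : f x ≤ N m := (le_max_left _ _).trans hm'
    have h2 : 1 / N m ≤ f x := by
      rw [one_div_le (hNpos m) hx]; exact (le_max_right _ _).trans hm'
    simp only [hF, llr]
    rw [min_eq_left h1, max_eq_right h2]
  have hllm : Measurable (llr ρ μ) := measurable_llr ρ μ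
  have hll : Integrable (llr ρ μ) ρ := by
    refine ⟨hllm.aestronglyMeasurable, ?_⟩
    rw [hasFiniteIntegral_iff_enorm]
    have h1 : ∫⁻ x, ‖llr ρ μ x‖ₑ ∂ρ
        = ∫⁻ x, liminf (fun m => ‖Real.log (F m x)‖ₑ) atTop ∂ρ := by
      apply lintegral_congr_ae
      filter_upwards [hconv] with x hx
      exact (hx.enorm.liminf_eq).symm
    rw [h1]
    refine lt_of_le_of_lt (lintegral_liminf_le (fun m => (hFm m).log.enorm)) ?_
    refine lt_of_le_of_lt (b := ENNReal.ofReal (L + Real.log 2 + 2)) ?_ ENNReal.ofReal_lt_top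
    apply liminf_le_of_frequently_le'
    apply Frequently.of_forall
    intro m
    rw [← ofReal_integral_norm_eq_lintegral_enorm (hLi m)]
    exact ENNReal.ofReal_le_ofReal (habs m)
  refine ⟨hac, hll, ?_⟩
  have hD : Tendsto (fun m => ∫ x, Real.log (F m x) ∂ρ) atTop (𝓝 (∫ x, llr ρ μ x ∂ρ)) := by
    apply tendsto_integral_of_dominated_convergence (fun x => |llr ρ μ x|)
      (fun m => (hFm m).log.aestronglyMeasurable) hll.abs _ hconv
    intro m
    filter_upwards [hpos] with x hx
    exact clamp_aux (N m) (f x) (hN1 m) hx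
  have hR : Tendsto (fun m => L + Real.log (1 + 1 / N m)) atTop (𝓝 (L + Real.log (1 + 0))) := by
    apply Tendsto.add tendsto_const_nhds
    apply Tendsto.log _ (by norm_num)
    apply Tendsto.add tendsto_const_nhds
    exact tendsto_one_div_add_atTop_nhds_zero_nat
  have := le_of_tendsto_of_tendsto' hD hR hstep
  simpa using this

def EE (a v : ℕ → ℝ) (n : ℕ) (h : ℝ → ℝ) : ℝ :=
  ∫ x, Nn v n * h x / (Xp a v n).eval x ∂ArcsineM

lemma arc_ae : ∀ᵐ x ∂ArcsineM, x ∈ Icc (-2:ℝ) 2 := by rw [ae_iff]; exact arc_supp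

lemma EE_contOn (a v : ℕ → ℝ) (h0 : v 0 = -1) (hv : ∀ k, |v (k+1)| < 1)
    (hav : ∀ k, (a (k+1))^2 = (1 - v k) * (1 + v (k+1))) (n : ℕ) (h : ℝ → ℝ)
    (hh : ContinuousOn h (Icc (-2) 2)) :
    ContinuousOn (fun x => Nn v n * h x / (Xp a v n).eval x) (Icc (-2) 2) := by
  apply ContinuousOn.div (hh.const_mul _) (Polynomial.continuous _).continuousOn
  intro x hx
  exact (X_pos a v h0 hv hav n x hx).ne'

lemma EE_mono (a v : ℕ → ℝ) (h0 : v 0 = -1) (hv : ∀ k, |v (k+1)| < 1)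
    (hav : ∀ k, (a (k+1))^2 = (1 - v k) * (1 + v (k+1))) (n : ℕ) (f h : ℝ → ℝ)
    (hf : ContinuousOn f (Icc (-2) 2))
    (hh : ContinuousOn h (Icc (-2) 2)) (hle : ∀ x ∈ Icc (-2:ℝ) 2, f x ≤ h x) :
    EE a v n f ≤ EE a v n h := by
  apply integral_mono_ae (arc_integrable _ (EE_contOn a v h0 hv hav n f hf))
    (arc_integrable _ (EE_contOn a v h0 hv hav n h hh))
  filter_upwards [arc_ae] with x hx
  have h1 := X_pos a v h0 hv hav n x hx
  have h2 := Nn_pos v hv n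
  have := hle x hx
  gcongr

lemma EE_poly (μ : Measure ℝ) [IsProbabilityMeasure μ] (hsupp : μ (Icc (-2) 2)ᶜ = 0)
    (a v : ℕ → ℝ) (ho : Orth μ a) (h0 : v 0 = -1) (hv : ∀ k, |v (k+1)| < 1)
    (hav : ∀ k, (a (k+1))^2 = (1 - v k) * (1 + v (k+1))) (hv1 : ∀ k, 0 < 1 - v k) (n : ℕ)
    (Q : ℝ[X]) (hQ : Q.natDegree ≤ n) :
    EE a v n (fun x => Q.eval x) = ∫ x, Q.eval x ∂μ := by
  rw [← match_poly μ hsupp a v ho h0 hv hav hv1 n Q hQ, EE,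
    arc_int _ (EE_contOn a v h0 hv hav n _ (Polynomial.continuous _).continuousOn), Lam,
    ← smul_eq_mul, ← circleAverage_smul]
  apply circleAverage_congr_sphere
  intro z hz
  have hz' : ‖z‖ = 1 := by simpa using hz
  simp only [Pi.smul_apply, smul_eq_mul, X_circle a v h0 hav z hz' n, mul_div_assoc]

lemma EE_lim (μ : Measure ℝ) [IsProbabilityMeasure μ] (hsupp : μ (Icc (-2) 2)ᶜ = 0)
    (a v : ℕ → ℝ) (ho : Orth μ a) (h0 : v 0 = -1) (hv : ∀ k, |v (k+1)| < 1)
    (hav : ∀ k, (a (k+1))^2 = (1 - v k) * (1 + v (k+1))) (hv1 : ∀ k, 0 < 1 - v k)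
    (h : ℝ → ℝ) (hh : Continuous h) :
    Tendsto (fun n => EE a v n h) atTop (𝓝 (∫ x, h x ∂μ)) := by
  rw [Metric.tendsto_atTop]
  intro ε hε
  obtain ⟨p, hp⟩ := exists_polynomial_near_of_continuousOn (-2) 2 h hh.continuousOn (ε/4) (by linarith)
  have hae : ∀ᵐ x ∂μ, x ∈ Icc (-2:ℝ) 2 := by rw [ae_iff]; exact hsupp
  have key : ∀ (d : ℝ), ∀ n ≥ p.natDegree, EE a v n (fun x => p.eval x + d) = ∫ x, p.eval x ∂μ + d := by
    intro d n hn
    have := EE_poly μ hsupp a v ho h0 hv hav hv1 n (p + C d) (by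
      rw [natDegree_add_C]; exact hn)
    simp only [eval_add, eval_C] at this
    rw [this, integral_add (int_poly μ hsupp p) (integrable_const _)]
    simp
  have hpi := int_poly μ hsupp p
  have hhi := int_cont μ hsupp h hh
  have hd : |∫ x, p.eval x ∂μ - ∫ x, h x ∂μ| ≤ ε/4 := by
    rw [← integral_sub hpi hhi]
    have := norm_integral_le_of_norm_le_const (μ := μ) (f := fun x => p.eval x - h x) (C := ε/4) (by
      filter_upwards [hae] with x hx
      exact (hp x hx).le)
    simpa using this
  refine ⟨p.natDegree, fun n hn => ?_⟩
  have hpc : ∀ d : ℝ, ContinuousOn (fun x => p.eval x + d) (Icc (-2) 2) := fun d =>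
    ((Polynomial.continuous p).add continuous_const).continuousOn
  have u := EE_mono a v h0 hv hav n h (fun x => p.eval x + ε/4) hh.continuousOn (hpc _) (by
    intro x hx
    have := (abs_lt.1 (hp x hx)).1
    linarith)
  have l := EE_mono a v h0 hv hav n (fun x => p.eval x + -(ε/4)) h (hpc _) hh.continuousOn (by
    intro x hx
    have := (abs_lt.1 (hp x hx)).2
    linarith)
  rw [key _ n hn] at u l
  rw [abs_le] at hd
  rw [Real.dist_eq, abs_lt]
  constructor <;> linarith

lemma stepD (g : ℝ) (hg : |g| ≤ 1)
    (a v : ℕ → ℝ) (h0 : v 0 = -1) (hv : ∀ k, |v (k+1)| < 1)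
    (hav : ∀ k, (a (k+1))^2 = (1 - v k) * (1 + v (k+1)))
    (φ : ℝ → ℝ) (hφ : Continuous φ) (n : ℕ) (hE : 0 < EE a v n (fun x => Real.exp (φ x))) :
    ∫ x, φ x ∂(rhog g) ≤ TT v |g| n + Real.log (EE a v n (fun x => Real.exp (φ x))) := by
  have := rho_prob g hg
  set c := EE a v n (fun x => Real.exp (φ x)) with hc
  set G : ℝ → ℝ := fun x => Nn v n * Real.exp (φ x) / (Xp a v n).eval x with hG
  have hGc : ContinuousOn G (Icc (-2) 2) := EE_contOn a v h0 hv hav n _ hφ.rexp.continuousOn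
  have hGi : Integrable G ArcsineM := arc_integrable _ hGc
  have hGm : Measurable G := by
    have := hφ.measurable
    have := (Polynomial.continuous (Xp a v n)).measurable
    fun_prop
  have hWm := (Wt_cont |g|).measurable
  have hN := Nn_pos v hv n
  have hG0 : ∀ x ∈ Icc (-2:ℝ) 2, 0 ≤ G x := by
    intro x hx
    have := X_pos a v h0 hv hav n x hx
    positivity
  have hle : ∀ x ∈ Icc (-2:ℝ) 2, Wt |g| x * (G x / Wt |g| x) ≤ G x := by
    intro x hx
    rcases eq_or_ne (Wt |g| x) 0 with h | h
    · rw [h, zero_mul]; exact hG0 x hx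
    · rw [mul_div_cancel₀ _ h]
  have hi0 : Integrable (fun x => Wt |g| x * (G x / Wt |g| x)) ArcsineM := by
    apply hGi.mono (hWm.mul (hGm.div hWm)).aestronglyMeasurable
    filter_upwards [arc_ae] with x hx
    have h1 := hG0 x hx
    have h2 := Wt_nonneg _ _ (abs_nonneg g) hg hx
    show ‖Wt |g| x * (G x / Wt |g| x)‖ ≤ ‖G x‖
    rw [Real.norm_of_nonneg h1, Real.norm_of_nonneg (mul_nonneg h2 (div_nonneg h1 h2))]
    exact hle x hx
  have hi : Integrable (fun x => G x / Wt |g| x) (rhog g) := by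
    rw [rhog_eq g hg, integrable_withDensity_iff_integrable_smul'
      hWm.ennreal_ofReal (by simp)]
    apply hi0.congr
    filter_upwards [arc_ae] with x hx
    rw [ENNReal.toReal_ofReal (Wt_nonneg _ _ (abs_nonneg _) hg hx), smul_eq_mul]
  have hI : ∫ x, G x / Wt |g| x ∂(rhog g) ≤ c := by
    rw [rho_int' g hg]
    apply integral_mono_ae hi0 hGi
    filter_upwards [arc_ae] with x hx
    exact hle x hx
  obtain ⟨hl, hlI⟩ := ell_int g hg a v h0 hv hav n
  have hφi : Integrable φ (rhog g) := rho_integrable g hg φ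
    ((Wt_cont _).mul hφ).continuousOn
  have hfin : ∫ x, (φ x - ell a v |g| n x) ∂(rhog g)
      ≤ ∫ x, (G x / Wt |g| x / c - 1 + Real.log c) ∂(rhog g) := by
    apply integral_mono_ae (ifsub hφi hl)
    · exact Integrable.fun_add (ifsub (hi.div_const c) (integrable_const _)) (integrable_const _)
    · filter_upwards [rho_ae_mem g hg, rho_ae_W g hg] with x h1 h2
      apply log_ineq _ _ _ hE
      have h3 := X_pos a v h0 hv hav n x h1
      rw [Real.exp_sub, ell, Real.exp_add, Real.exp_sub, Real.exp_log h3, Real.exp_log hN,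
        Real.exp_log h2]
      simp only [hG]
      field_simp
  rw [integral_sub hφi hl, integral_add (ifsub (hi.div_const c) (integrable_const _))
    (integrable_const _), integral_sub (hi.div_const c) (integrable_const _), integral_div, hlI] at hfin
  simp at hfin
  have : (∫ x, G x / Wt |g| x ∂(rhog g)) / c ≤ 1 := (div_le_one hE).2 hI
  linarith

lemma stepL (g : ℝ) (hg : |g| ≤ 1) (μ : Measure ℝ) [IsProbabilityMeasure μ]
    (hsupp : μ (Icc (-2) 2)ᶜ = 0)
    (a v : ℕ → ℝ) (ho : Orth μ a) (h0 : v 0 = -1) (hv : ∀ k, |v (k+1)| < 1)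
    (hav : ∀ k, (a (k+1))^2 = (1 - v k) * (1 + v (k+1))) (hv1 : ∀ k, 0 < 1 - v k) (L : ℝ)
    (hL : ∃ᶠ n in atTop, TT v |g| n ≤ L) :
    rhog g ≪ μ ∧ Integrable (llr (rhog g) μ) (rhog g) ∧ ∫ x, llr (rhog g) μ x ∂(rhog g) ≤ L := by
  have := rho_prob g hg
  apply lsc
  intro φ hφ _
  have hlim := EE_lim μ hsupp a v ho h0 hv hav hv1 _ hφ.rexp
  have hpos : 0 < ∫ x, Real.exp (φ x) ∂μ := integral_exp_pos (int_cont μ hsupp _ hφ.rexp)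
  have hlim2 : Tendsto (fun n => L + Real.log (EE a v n (fun x => Real.exp (φ x)))) atTop
      (𝓝 (L + Real.log (∫ x, Real.exp (φ x) ∂μ))) :=
    tendsto_const_nhds.add (hlim.log hpos.ne')
  apply ge_of_tendsto_of_frequently hlim2
  apply (hL.and_eventually (hlim.eventually (lt_mem_nhds hpos))).mono
  intro n hn
  have := stepD g hg a v h0 hv hav φ hφ n hn.2
  linarith [hn.1]

lemma stepE (g : ℝ) (hg : |g| ≤ 1) (μ : Measure ℝ) [IsProbabilityMeasure μ]
    (hsupp : μ (Icc (-2) 2)ᶜ = 0)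
    (a v : ℕ → ℝ) (ho : Orth μ a) (h0 : v 0 = -1) (hv : ∀ k, |v (k+1)| < 1)
    (hav : ∀ k, (a (k+1))^2 = (1 - v k) * (1 + v (k+1)))
    (hac : rhog g ≪ μ) (hll : Integrable (llr (rhog g) μ) (rhog g)) (n : ℕ) (hn : |v n| ≤ 1) :
    0 < 1 + |g| * (v n * v (n+1)) ∧
    TT v |g| n ≤ ∫ x, llr (rhog g) μ x ∂(rhog g) + Real.log (1 + |g| * (v n * v (n+1))) := by
  have := rho_prob g hg
  have hN := Nn_pos v hv n
  have hae : ∀ᵐ x ∂μ, x ∈ Icc (-2:ℝ) 2 := by rw [ae_iff]; exact hsupp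
  have hpos : 0 < 1 + |g| * (v n * v (n+1)) := by
    have h1 : |(|g| * (v n * v (n+1)))| < 1 := by
      rw [abs_mul, abs_mul, abs_abs]
      have h2 : |v n| * |v (n+1)| ≤ |v (n+1)| := mul_le_of_le_one_left (abs_nonneg _) hn
      have h3 : |g| * (|v n| * |v (n+1)|) ≤ |v n| * |v (n+1)| :=
        mul_le_of_le_one_left (by positivity) hg
      linarith [hv n]
    linarith [(abs_lt.1 h1).1]
  refine ⟨hpos, ?_⟩
  set H : ℝ → ℝ := fun x => (Xp a v n).eval x / Nn v n * Wt |g| x with hH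
  have hHc : Continuous H := by
    have := Polynomial.continuous (Xp a v n)
    have := Wt_cont |g|
    fun_prop
  have hXc : Continuous (fun x => (4 - x^2)/2 * (Xp a v n).eval x) := by
    have := Polynomial.continuous (Xp a v n)
    fun_prop
  have hHI : ∫ x, H x ∂μ = 1 + |g| * (v n * v (n+1)) := by
    have e : H = fun x => (|g| / Nn v n) * ((4 - x^2)/2 * (Xp a v n).eval x)
        + ((1 - |g|) / Nn v n) * (Xp a v n).eval x := by
      ext x
      simp only [hH, Wt]
      field_simp
      ring
    rw [e, integral_add ((int_cont μ hsupp _ hXc).const_mul _) ((int_poly μ hsupp _).const_mul _),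
      integral_const_mul, integral_const_mul, int_XD μ hsupp a v ho h0 hav, int_X μ hsupp a v ho h0 hav]
    field_simp
    ring
  obtain ⟨hl, hlI⟩ := ell_int g hg a v h0 hv hav n
  have h := DV (rhog g) μ hac hll (ell a v |g| n) H hl (int_cont μ hsupp _ hHc) (by
    filter_upwards [rho_ae_mem g hg, rho_ae_W g hg] with x h1 h2
    have h3 := X_pos a v h0 hv hav n x h1
    rw [ell, Real.exp_add, Real.exp_sub, Real.exp_log h3, Real.exp_log hN, Real.exp_log h2]) (by
    filter_upwards [hae] with x h1
    have h3 := X_pos a v h0 hv hav n x h1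
    have h2 := Wt_nonneg _ _ (abs_nonneg g) hg h1
    simp only [hH]
    positivity) (by rw [hHI]; exact hpos)
  rw [hHI, hlI] at h
  linarith

lemma log_quad (y : ℝ) (h0 : 0 ≤ y) (h1 : y < 1) : y + y^2/2 ≤ -Real.log (1 - y) := by
  have h := Real.hasSum_pow_div_log_of_abs_lt_one (x := y) (by rw [abs_of_nonneg h0]; exact h1)
  have := sum_le_hasSum (Finset.range 2) (fun i _ => by positivity) h
  simp [Finset.sum_range_succ] at this
  norm_num at this
  linarith

lemma TT_lower (v : ℕ → ℝ) (h0 : v 0 = -1) (hv : ∀ k, |v (k+1)| < 1) (γ : ℝ) (hγ0 : 0 ≤ γ)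
    (hγ1 : γ ≤ 1) (n : ℕ) :
    (∑ k ∈ Finset.range n, (v (k+1))^4) / 2 + (v n)^2 / 2 - 1/2 + Jf γ ≤ TT v γ n := by
  induction n with
  | zero => simp [TT, Nn, h0]
  | succ n ih =>
    have hN := Nn_pos v hv n
    have h2 : (v (n+1))^2 < 1 := by
      rw [sq_lt_one_iff_abs_lt_one]; exact hv n
    have h3 := log_quad ((v (n+1))^2) (sq_nonneg _) h2
    have hs : TT v γ (n+1) = TT v γ n - γ * (v (n+1) * v n) - Real.log (1 - (v (n+1))^2) := by
      rw [TT, TT, Nn_succ, Real.log_mul hN.ne' (by linarith), Finset.sum_range_succ]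
      ring
    have h4 : γ * (v (n+1) * v n) ≤ ((v (n+1))^2 + (v n)^2)/2 := by
      have h5 : v (n+1) * v n ≤ ((v (n+1))^2 + (v n)^2)/2 := by nlinarith [sq_nonneg (v (n+1) - v n)]
      have h6 : 0 ≤ ((v (n+1))^2 + (v n)^2)/2 := by positivity
      nlinarith
    rw [hs, Finset.sum_range_succ]
    nlinarith

lemma v_lim (v : ℕ → ℝ) (h0 : v 0 = -1) (hv : ∀ k, |v (k+1)| < 1) (γ : ℝ) (hγ0 : 0 ≤ γ)
    (hγ1 : γ ≤ 1) (B : ℝ) (hB : ∀ n, TT v γ n ≤ B) : Tendsto v atTop (𝓝 0) := by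
  have hs : Summable (fun k => (v (k+1))^4) := by
    apply summable_of_sum_range_le (c := 2 * (B + 1/2 - Jf γ)) (fun k => by positivity)
    intro n
    have := TT_lower v h0 hv γ hγ0 hγ1 n
    have := hB n
    have := sq_nonneg (v n)
    linarith
  have h1 := hs.tendsto_atTop_zero
  have h2 := h1.sqrt.sqrt
  rw [← tendsto_add_atTop_iff_nat 1]
  rw [tendsto_zero_iff_abs_tendsto_zero]
  simp only [Real.sqrt_zero] at h2
  refine h2.congr (fun k => ?_)
  have e : v (k+1)^4 = (v (k+1)^2)^2 := by ring
  rw [e, Real.sqrt_sq (sq_nonneg _), Real.sqrt_sq_eq_abs]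
  rfl

lemma S_eq (g : ℝ) (a v : ℕ → ℝ) (h0 : v 0 = -1) (hv : ∀ k, |v (k+1)| < 1)
    (ha : ∀ k, 0 < a (k+1))
    (hav : ∀ k, (a (k+1))^2 = (1 - v k) * (1 + v (k+1))) (hv1 : ∀ k, 0 < 1 - v k) (n : ℕ) :
    Cg g + |g| * ∑ k ∈ Finset.range n, ((a (k+1))^2 - 1 - Real.log ((a (k+1))^2))
          + (1 - |g|) * (Real.log 2 - ∑ k ∈ Finset.range n, Real.log ((a (k+1))^2))
    = TT v |g| n + |g| * v n + Real.log (1 - v n) := by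
  have hl : ∑ k ∈ Finset.range n, Real.log ((a (k+1))^2)
      = Real.log 2 + Real.log (Nn v n) - Real.log (1 - v n) := by
    rw [← Real.log_prod (fun k _ => (pow_pos (ha k) 2).ne')]
    have h1 := Pi2_N a v h0 hav n
    have h2 := Pi2_pos a ha n
    have h3 := Nn_pos v hv n
    rw [← Real.log_mul (by norm_num) h3.ne', ← h1, Real.log_mul h2.ne' (hv1 n).ne', Pi2]
    ring
  have hs : ∑ k ∈ Finset.range n, ((a (k+1))^2 - 1)
      = v n + 1 - ∑ k ∈ Finset.range n, v (k+1) * v k := by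
    clear hl
    induction n with
    | zero => simp [h0]
    | succ n ih => rw [Finset.sum_range_succ, ih, Finset.sum_range_succ, hav n]; ring
  rw [Finset.sum_sub_distrib, hs, hl, TT, Cg, Jf, sq_abs]
  ring

lemma main_fin (g : ℝ) (hg : |g| ≤ 1) (μ : Measure ℝ) [IsProbabilityMeasure μ]
    (hsupp : μ (Icc (-2) 2)ᶜ = 0)
    (a v : ℕ → ℝ) (ho : Orth μ a) (h0 : v 0 = -1) (hv : ∀ k, |v (k+1)| < 1)
    (hav : ∀ k, (a (k+1))^2 = (1 - v k) * (1 + v (k+1))) (hv1 : ∀ k, 0 < 1 - v k)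
    (hac : rhog g ≪ μ) (hll : Integrable (llr (rhog g) μ) (rhog g)) :
    Tendsto (fun n => TT v |g| n + |g| * v n + Real.log (1 - v n)) atTop
      (𝓝 (∫ x, llr (rhog g) μ x ∂(rhog g))) := by
  set K := ∫ x, llr (rhog g) μ x ∂(rhog g) with hK
  have hvn : ∀ n, |v n| ≤ 1 := by
    intro n
    cases n with
    | zero => rw [h0]; norm_num
    | succ n => exact (hv n).le
  have hE := fun n => stepE g hg μ hsupp a v ho h0 hv hav hac hll n (hvn n)
  have hB : ∀ n, TT v |g| n ≤ K + Real.log 2 := by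
    intro n
    obtain ⟨h1, h2⟩ := hE n
    have h3 : |g| * (v n * v (n+1)) ≤ 1 := by
      have h4 : |(|g| * (v n * v (n+1)))| ≤ 1 := by
        rw [abs_mul, abs_mul, abs_abs]
        exact mul_le_one₀ hg (by positivity) (mul_le_one₀ (hvn n) (abs_nonneg _) (hvn _))
      exact (le_abs_self _).trans h4
    have := Real.log_le_log h1 (by linarith : 1 + |g| * (v n * v (n+1)) ≤ 2)
    linarith
  have hvl := v_lim v h0 hv |g| (abs_nonneg g) hg _ hB
  have hT : Tendsto (fun n => TT v |g| n) atTop (𝓝 K) := by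
    have hu : Tendsto (fun n => K + Real.log (1 + |g| * (v n * v (n+1)))) atTop
        (𝓝 (K + Real.log (1 + |g| * (0 * 0)))) := by
      apply tendsto_const_nhds.add
      apply Tendsto.log
      · exact tendsto_const_nhds.add ((hvl.mul ((tendsto_add_atTop_iff_nat 1).2 hvl)).const_mul _)
      · norm_num
    simp at hu
    rw [tendsto_order]
    constructor
    · intro L hL
      by_contra hcon
      rw [Filter.not_eventually] at hcon
      have := (stepL g hg μ hsupp a v ho h0 hv hav hv1 L (hcon.mono fun n hn => not_lt.1 hn)).2.2
      linarith
    · intro L hL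
      filter_upwards [hu.eventually (gt_mem_nhds hL)] with n hn
      exact (hE n).2.trans_lt hn
  have := (hT.add (hvl.const_mul |g|)).add (((tendsto_const_nhds (x := (1:ℝ))).sub hvl).log (by norm_num))
  simpa using this

lemma main_inf (g : ℝ) (hg : |g| ≤ 1) (μ : Measure ℝ) [IsProbabilityMeasure μ]
    (hsupp : μ (Icc (-2) 2)ᶜ = 0)
    (a v : ℕ → ℝ) (ho : Orth μ a) (h0 : v 0 = -1) (hv : ∀ k, |v (k+1)| < 1)
    (hav : ∀ k, (a (k+1))^2 = (1 - v k) * (1 + v (k+1))) (hv1 : ∀ k, 0 < 1 - v k)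
    (hno : ¬ (rhog g ≪ μ ∧ Integrable (llr (rhog g) μ) (rhog g))) :
    Tendsto (fun n => TT v |g| n + |g| * v n + Real.log (1 - v n)) atTop atTop := by
  have hvn : ∀ n, |v n| ≤ 1 := by
    intro n
    cases n with
    | zero => rw [h0]; norm_num
    | succ n => exact (hv n).le
  have hT : Tendsto (fun n => TT v |g| n) atTop atTop := by
    rw [tendsto_atTop]
    intro L
    by_contra hcon
    rw [Filter.not_eventually] at hcon
    have := stepL g hg μ hsupp a v ho h0 hv hav hv1 L (hcon.mono fun n hn => (not_le.1 hn).le)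
    exact hno ⟨this.1, this.2.1⟩
  rw [← tendsto_add_atTop_iff_nat 1]
  apply tendsto_atTop_mono _ (tendsto_atTop_add_const_right _ (-2 - Real.log 2) hT)
  intro n
  have hN := Nn_pos v hv n
  obtain ⟨l1, l2⟩ := abs_lt.1 (hv n)
  have hs : TT v |g| (n+1) = TT v |g| n - |g| * (v (n+1) * v n) - Real.log (1 - (v (n+1))^2) := by
    rw [TT, TT, Nn_succ, Real.log_mul hN.ne' (by nlinarith), Finset.sum_range_succ]
    ring
  have e : Real.log (1 - (v (n+1))^2) = Real.log (1 - v (n+1)) + Real.log (1 + v (n+1)) := by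
    rw [← Real.log_mul (by linarith) (by linarith)]; ring_nf
  have h3 : Real.log (1 + v (n+1)) ≤ Real.log 2 := Real.log_le_log (by linarith) (by linarith)
  have h4 : |(|g| * (v (n+1) * v n))| ≤ 1 := by
    rw [abs_mul, abs_mul, abs_abs]
    exact mul_le_one₀ hg (by positivity) (mul_le_one₀ (hvn _) (abs_nonneg _) (hvn _))
  have h5 : |(|g| * v (n+1))| ≤ 1 := by
    rw [abs_mul, abs_abs]
    exact mul_le_one₀ hg (by positivity) (hvn _)
  have := (abs_le.1 h5).1
  have := (abs_le.1 h4).2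
  rw [hs, e]
  linarith

/-- Alternative coefficient side for the mixture `ρ_g`; the mixed-sign series on the
right-hand side is interpreted as the limit of its partial sums. -/
theorem rho_g_alternative_sum_rule (g : ℝ) (hg1 : -1 ≤ g) (hg0 : g ≤ 0)
    (μ : Measure ℝ) [IsProbabilityMeasure μ] (hsupp : μ (Icc (-2) 2)ᶜ = 0)
    (hsym : μ.map (fun x => -x) = μ) (hnt : InfiniteSupport μ)
    (a b : ℕ → ℝ) (hab : IsJacobi μ a b) (hb : ∀ k : ℕ, b (k+1) = 0) :
    (KLdiv (rhog g) μ ≠ ⊤ →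
      Tendsto (fun n : ℕ => Cg g
          + |g| * ∑ k ∈ Finset.range n, ((a (k+1))^2 - 1 - Real.log ((a (k+1))^2))
          + (1 - |g|) * (Real.log 2 - ∑ k ∈ Finset.range n, Real.log ((a (k+1))^2)))
        atTop (𝓝 ((KLdiv (rhog g) μ).toReal))) ∧
    (KLdiv (rhog g) μ = ⊤ →
      Tendsto (fun n : ℕ => Cg g
          + |g| * ∑ k ∈ Finset.range n, ((a (k+1))^2 - 1 - Real.log ((a (k+1))^2))
          + (1 - |g|) * (Real.log 2 - ∑ k ∈ Finset.range n, Real.log ((a (k+1))^2)))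
        atTop atTop) := by
  have hg : |g| ≤ 1 := abs_le.2 ⟨hg1, by linarith⟩
  have := rho_prob g hg
  have ho := orth_of_jac μ a b hab hb
  obtain ⟨hv1, hv, hav⟩ := vv_facts μ hsupp a ho
  have h0 : vv a 0 = -1 := rfl
  have hS := S_eq g a (vv a) h0 hv hab.1 hav hv1
  simp only [hS]
  by_cases hc : rhog g ≪ μ ∧ Integrable (llr (rhog g) μ) (rhog g)
  · have hK : KLdiv (rhog g) μ = ENNReal.ofReal (∫ x, llr (rhog g) μ x ∂(rhog g)) := if_pos hc
    have hpos : 0 ≤ ∫ x, llr (rhog g) μ x ∂(rhog g) := by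
      have := DV (rhog g) μ hc.1 hc.2 (fun _ => 0) (fun _ => 1) (integrable_const _)
        (integrable_const _) (by simp) (by simp) (by simp)
      simpa using this
    refine ⟨fun _ => ?_, fun h => ?_⟩
    · rw [hK, ENNReal.toReal_ofReal hpos]
      exact main_fin g hg μ hsupp a (vv a) ho h0 hv hav hv1 hc.1 hc.2
    · rw [hK] at h
      exact absurd h ENNReal.ofReal_ne_top
  · have hK : KLdiv (rhog g) μ = ⊤ := if_neg hc
    exact ⟨fun h => absurd hK h, fun _ => main_inf g hg μ hsupp a (vv a) ho h0 hv hav hv1 hc⟩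

end SumRules
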